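/- arXiv:1703.06459 — 2 statements merged into one kernel-verified Lean document; each statement's English description precedes it below -/
import Mathlib

section
/- Let (W,w) be a pointed domain. Then ∂W is locally connected if and only if there exist a > 0 and a Carathéodory modulus η : (0,a) → ℝ for (W,w) with η(r) → 0 as r → 0⁺. -/
open Complex

/-- `γ` is a crosscut of `W`: the image of `(0,1)` under a continuous injective
map `g : [0,1] → ℂ` whose open part lies in `W` and whose endpoints are on the
boundary of `W`. -/
def IsCrosscut (W γ : Set ℂ) : Prop :=
  ∃ g : ℝ → ℂ, ContinuousOn g (Set.Icc 0 1) ∧ Set.InjOn g (Set.Icc 0 1) ∧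
    γ = g '' Set.Ioo 0 1 ∧ g '' Set.Ioo 0 1 ⊆ W ∧
    g 0 ∈ frontier W ∧ g 1 ∈ frontier W

/-- The crosscut neighborhood `N_γ`: the union of the connected components of
`W ∖ γ` which do not contain the base point `w`. -/
def crosscutNbhd (W : Set ℂ) (w : ℂ) (γ : Set ℂ) : Set ℂ :=
  {z : ℂ | z ∈ W \ γ ∧ w ∉ connectedComponentIn (W \ γ) z}

/-- `η : (0,a) → ℝ` is a Carathéodory modulus for `(W, w)`: it is strictly
increasing, and every crosscut `γ` missing `w` with `diam (closure γ) < r < a`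
has crosscut neighborhood of diameter less than `η r`. -/
def IsCaratheodoryModulus (W : Set ℂ) (w : ℂ) (a : ℝ) (η : ℝ → ℝ) : Prop :=
  StrictMonoOn η (Set.Ioo 0 a) ∧
  ∀ γ : Set ℂ, IsCrosscut W γ → w ∉ γ → ∀ r : ℝ,
    Metric.diam (closure γ) < r → r < a →
      Metric.diam (crosscutNbhd W w γ) < η r

/-- A continuous branch of `log ((x - p) / (x - q))` exists on `K`. -/
def HasLogRatio (K : Set ℂ) (p q : ℂ) : Prop :=
  ∃ g : ℂ → ℂ, ContinuousOn g K ∧ ∀ x ∈ K, x - p = exp (g x) * (x - q)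

theorem HasLogRatio.mono {K L : Set ℂ} {p q : ℂ} (h : HasLogRatio L p q) (hKL : K ⊆ L) :
    HasLogRatio K p q :=
  let ⟨g, hg, hgx⟩ := h
  ⟨g, hg.mono hKL, fun x hx => hgx x (hKL hx)⟩

theorem HasLogRatio.symm {K : Set ℂ} {p q : ℂ} (h : HasLogRatio K p q) : HasLogRatio K q p := by
  obtain ⟨g, hg, hgx⟩ := h
  refine ⟨fun x => -g x, hg.neg, fun x hx => ?_⟩
  rw [hgx x hx, ← mul_assoc, ← exp_add]
  simp

theorem HasLogRatio.trans {K : Set ℂ} {p q r : ℂ} (h : HasLogRatio K p q)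
    (h' : HasLogRatio K q r) : HasLogRatio K p r := by
  obtain ⟨g, hg, hgx⟩ := h
  obtain ⟨g', hg', hgx'⟩ := h'
  refine ⟨fun x => g x + g' x, hg.add hg', fun x hx => ?_⟩
  rw [hgx x hx, hgx' x hx, exp_add]
  ring

theorem hasLogRatio_of_dist_lt {K : Set ℂ} {p q : ℂ} (h : ∀ x ∈ K, ‖p - q‖ < ‖x - p‖) :
    HasLogRatio K p q := by
  have hne : ∀ x ∈ K, x - p ≠ 0 := fun x hx =>
    norm_pos_iff.mp ((norm_nonneg _).trans_lt (h x hx))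
  have hslit : ∀ x ∈ K, 1 + (p - q) / (x - p) ∈ slitPlane := fun x hx => by
    apply mem_slitPlane_of_norm_lt_one
    rw [norm_div, div_lt_one (norm_pos_iff.mpr (hne x hx))]
    exact h x hx
  refine HasLogRatio.symm ⟨fun x => log (1 + (p - q) / (x - p)), ?_, fun x hx => ?_⟩
  · refine ContinuousOn.clog ?_ hslit
    exact continuousOn_const.add
      (continuousOn_const.div (continuousOn_id.sub continuousOn_const) hne)
  · rw [exp_log (slitPlane_ne_zero (hslit x hx))]
    have := hne x hx
    field_simp
    ring

/-- Points in the same connected subset of the complement of a closed set `K` have a continuous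
logarithm of their ratio on `K`. -/
theorem hasLogRatio_of_isPreconnected {K C : Set ℂ} (hK : IsClosed K) (hC : IsPreconnected C)
    (hCK : Disjoint C K) {p q : ℂ} (hp : p ∈ C) (hq : q ∈ C) : HasLogRatio K p q := by
  refine hC.induction₂ (HasLogRatio K) (fun x hx => ?_) (fun _ _ _ _ _ _ => .trans)
    (fun _ _ _ _ => .symm) hp hq
  have hxK : Kᶜ ∈ nhds x := hK.isOpen_compl.mem_nhds (hCK.notMem_of_mem_left hx)
  obtain ⟨ε, hε, hball⟩ := Metric.mem_nhds_iff.mp hxK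
  filter_upwards [mem_nhdsWithin_of_mem_nhds (Metric.ball_mem_nhds x hε)] with y hy
  refine hasLogRatio_of_dist_lt fun z hz => ?_
  have h1 : ¬ dist z x < ε := fun h => hball h hz
  rw [Metric.mem_ball, dist_comm, dist_eq_norm] at hy
  rw [dist_eq_norm] at h1
  linarith

theorem exists_log_sub_of_convex {K : Set ℂ} (hK : Convex ℝ K) (hKc : IsClosed K) {p : ℂ}
    (hp : p ∉ K) : ∃ g : ℂ → ℂ, ContinuousOn g K ∧ ∀ x ∈ K, x - p = exp (g x) := by
  obtain ⟨f, u, hfp, hfK⟩ := RCLike.geometric_hahn_banach_point_closed (𝕜 := ℂ) hK hKc hp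
  have hpos : ∀ x ∈ K, 0 < (f (x - p)).re := fun x hx => by
    have := hfK x hx
    simp only [RCLike.re_eq_complex_re] at *
    rw [map_sub, sub_re]
    linarith
  have hslit : ∀ x ∈ K, f (x - p) ∈ slitPlane := fun x hx => Or.inl (hpos x hx)
  have hlin : ∀ z : ℂ, f z = z * f 1 := fun z => by
    simpa using f.map_smul z 1
  refine ⟨fun x => log (f (x - p)) - log (f 1), ?_, fun x hx => ?_⟩
  · exact (ContinuousOn.clog (by fun_prop) hslit).sub continuousOn_const
  · have h0 := slitPlane_ne_zero (hslit x hx)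
    have h1 : f 1 ≠ 0 := fun h => h0 (by rw [hlin, h, mul_zero])
    rw [exp_sub, exp_log h0, exp_log h1, hlin (x - p)]
    field_simp

theorem hasLogRatio_of_exists_log {K : Set ℂ} {p q : ℂ}
    (hp : ∃ g : ℂ → ℂ, ContinuousOn g K ∧ ∀ x ∈ K, x - p = exp (g x))
    (hq : ∃ g : ℂ → ℂ, ContinuousOn g K ∧ ∀ x ∈ K, x - q = exp (g x)) : HasLogRatio K p q := by
  obtain ⟨g, hg, hgx⟩ := hp
  obtain ⟨g', hg', hgx'⟩ := hq
  refine ⟨fun x => g x - g' x, hg.sub hg', fun x hx => ?_⟩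
  rw [hgx x hx, hgx' x hx, ← exp_add]
  simp

theorem hasLogRatio_of_convex {K : Set ℂ} (hK : Convex ℝ K) (hKc : IsClosed K) {p q : ℂ}
    (hp : p ∉ K) (hq : q ∉ K) : HasLogRatio K p q :=
  hasLogRatio_of_exists_log (exists_log_sub_of_convex hK hKc hp)
    (exists_log_sub_of_convex hK hKc hq)

theorem eq_zero_of_exp_eq_one_of_norm_lt {z : ℂ} (hz : exp z = 1) (h : ‖z‖ < 1) : z = 0 := by
  obtain ⟨n, rfl⟩ := exp_eq_one_iff.mp hz
  have : |(n : ℝ)| * (2 * Real.pi) < 1 := by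
    simpa [abs_of_pos Real.pi_pos] using h
  have hn : |(n : ℝ)| < 1 := by nlinarith [Real.pi_gt_three, abs_nonneg (n : ℝ)]
  have hn' : |n| < 1 := by exact_mod_cast hn
  simp [Int.abs_lt_one_iff.mp hn']

theorem IsPreconnected.eq_of_exp_eq_one {X : Type*} [TopologicalSpace X] {S : Set X}
    (hS : IsPreconnected S) {h : X → ℂ} (hc : ContinuousOn h S) (he : ∀ x ∈ S, exp (h x) = 1)
    {x y : X} (hx : x ∈ S) (hy : y ∈ S) : h x = h y := by
  refine hS.induction₂ (fun x y => h x = h y) (fun x hx => ?_) (fun _ _ _ _ _ _ => Eq.trans)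
    (fun _ _ _ _ => Eq.symm) hx hy
  filter_upwards [(hc x hx) (Metric.ball_mem_nhds (h x) one_pos), self_mem_nhdsWithin] with y hy hyS
  have hb : ‖h y - h x‖ < 1 := by simpa [dist_eq_norm] using hy
  refine (sub_eq_zero.mp (eq_zero_of_exp_eq_one_of_norm_lt ?_ hb)).symm
  rw [exp_sub, he x hx, he y hyS, div_one]

/-- The gluing step in Janiszewski's theorem. -/
theorem HasLogRatio.union {A B : Set ℂ} (hA : IsClosed A) (hB : IsClosed B)
    (hAB : IsPreconnected (A ∩ B)) {p q : ℂ} (hq : q ∉ A ∩ B) (h : HasLogRatio A p q)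
    (h' : HasLogRatio B p q) : HasLogRatio (A ∪ B) p q := by
  classical
  obtain ⟨g, hg, hgx⟩ := h
  obtain ⟨g', hg', hgx'⟩ := h'
  have hexp : ∀ x ∈ A ∩ B, exp (g x - g' x) = 1 := fun x hx => by
    have h1 := hgx x hx.1
    rw [hgx' x hx.2] at h1
    have hne : x - q ≠ 0 := sub_ne_zero.mpr fun h => hq (h ▸ hx)
    rw [exp_sub, ← mul_right_cancel₀ hne h1, div_self (exp_ne_zero _)]
  obtain ⟨c, hc, hcx⟩ : ∃ c : ℂ, exp c = 1 ∧ ∀ x ∈ A ∩ B, g x = g' x + c := by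
    rcases (A ∩ B).eq_empty_or_nonempty with h0 | ⟨y, hy⟩
    · exact ⟨0, exp_zero, by simp [h0]⟩
    · refine ⟨g y - g' y, hexp y hy, fun x hx => ?_⟩
      have := hAB.eq_of_exp_eq_one (h := fun x => g x - g' x) ((hg.mono Set.inter_subset_left).sub
        (hg'.mono Set.inter_subset_right)) hexp hx hy
      linear_combination this
  refine ⟨A.piecewise g fun x => g' x + c, ContinuousOn.union_of_isClosed ?_ ?_ hA hB, ?_⟩
  · exact hg.congr fun x hx => A.piecewise_eq_of_mem _ _ hx
  · refine (hg'.add continuousOn_const).congr (f := fun x => g' x + c) fun x hx => ?_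
    by_cases hxA : x ∈ A
    · rw [A.piecewise_eq_of_mem _ _ hxA, hcx x ⟨hxA, hx⟩]
    · rw [A.piecewise_eq_of_notMem _ _ hxA]
  · intro x hx
    by_cases hxA : x ∈ A
    · rw [A.piecewise_eq_of_mem _ _ hxA, hgx x hxA]
    · rw [A.piecewise_eq_of_notMem _ _ hxA, exp_add, hc, mul_one]
      exact hgx' x (hx.resolve_left hxA)

theorem exists_log_of_isSimplyConnected {U : Set ℂ} (hU : SimplyConnectedSpace U) (hUo : IsOpen U)
    {f : ℂ → ℂ} (hf : ContinuousOn f U) (hf0 : ∀ x ∈ U, f x ≠ 0) :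
    ∃ g : ℂ → ℂ, ContinuousOn g U ∧ ∀ x ∈ U, f x = exp (g x) := by
  obtain ⟨g, hg, hgx⟩ := exists_continuousOn_eqOn_exp_comp (U := U) hU hUo hf
    (by rintro ⟨x, hx, h⟩; exact hf0 x hx h)
  exact ⟨g, hg, fun x hx => (hgx hx).symm⟩

/-- `z - p` on a neighbourhood of infinity has no continuous nonvanishing extension to `ℂ`. -/
theorem not_exists_nonvanishing_extension {F : ℂ → ℂ} (hF : Continuous F) (hF0 : ∀ z, F z ≠ 0)
    {S : Set ℂ} (hS : Bornology.IsBounded S) {p : ℂ} (hFS : ∀ z ∉ S, F z = z - p) : False := by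
  have : SimplyConnectedSpace (Set.univ : Set ℂ) :=
    (Homeomorph.Set.univ ℂ).toHomotopyEquiv.simplyConnectedSpace
  obtain ⟨G, hG, hGx⟩ := exists_log_of_isSimplyConnected this isOpen_univ hF.continuousOn
    fun x _ => hF0 x
  obtain ⟨R, hR, hSR⟩ := hS.subset_ball_lt 0 p
  set z : ℝ → ℂ := circleMap p R with hz
  have hzS : ∀ t, F (z t) = R * exp (t * I) := fun t => by
    rw [hFS]
    · simp [hz, circleMap]
    · intro h
      have := hSR h
      simp [hz, circleMap, abs_of_pos hR] at this
  have key := isPreconnected_univ.eq_of_exp_eq_one (X := ℝ)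
    (h := fun t => G (z t) - t * I - Real.log R)
    (by
      have : Continuous fun t => G (z t) :=
        (continuousOn_univ.mp hG).comp (continuous_circleMap p R)
      exact ((this.sub (by fun_prop)).sub continuous_const).continuousOn)
    (fun t _ => by
      rw [exp_sub, exp_sub, ← hGx _ trivial, hzS, ← ofReal_exp, Real.exp_log hR]
      have hR' : (R : ℂ) ≠ 0 := by exact_mod_cast hR.ne'
      field_simp [exp_ne_zero]) (Set.mem_univ 0) (Set.mem_univ (2 * Real.pi))
  have h0 : z (2 * Real.pi) = z 0 := by simp [hz, circleMap]
  rw [h0, ofReal_zero, zero_mul, sub_zero] at key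
  have hpi : (Real.pi : ℂ) * I = 0 := by
    push_cast at key
    linear_combination key / 2
  simp [Real.pi_ne_zero] at hpi

/-- The boundary of a bounded open set separates its points from the points outside. -/
theorem not_hasLogRatio_frontier {V : Set ℂ} (hVb : Bornology.IsBounded V)
    {p q : ℂ} (hp : p ∈ V) (hq : q ∉ closure V) : ¬ HasLogRatio (frontier V) p q := by
  classical
  rintro ⟨g, hg, hgx⟩
  obtain ⟨G, hG⟩ := ContinuousMap.exists_restrict_eq (s := frontier V) isClosed_frontier
    ⟨(frontier V).domRestrict g, continuousOn_iff_continuous_domRestrict.mp hg⟩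
  have hGx : ∀ x ∈ frontier V, G x = g x := fun x hx => DFunLike.congr_fun hG ⟨x, hx⟩
  have hqV : ∀ z ∈ V, z - q ≠ 0 := fun z hz h => hq (subset_closure (sub_eq_zero.mp h ▸ hz))
  refine not_exists_nonvanishing_extension (F := V.piecewise (fun z => exp (G z) * (z - q))
    fun z => z - p) ?_ (fun z => ?_) hVb (p := p) fun z hz => V.piecewise_eq_of_notMem _ _ hz
  · refine Continuous.piecewise (fun x hx => ?_) (by fun_prop) (by fun_prop)
    rw [hGx x hx, hgx x hx]
  · by_cases hz : z ∈ V
    · rw [V.piecewise_eq_of_mem _ _ hz]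
      exact mul_ne_zero (exp_ne_zero _) (hqV z hz)
    · rw [V.piecewise_eq_of_notMem _ _ hz]
      exact sub_ne_zero.mpr fun h => hz (h ▸ hp)

theorem isPreconnected_compl_closedBall_zero {R : ℝ} (hR : 0 < R) :
    IsPreconnected (Metric.closedBall (0 : ℂ) R)ᶜ := by
  have h : (Metric.closedBall (0 : ℂ) R)ᶜ = exp '' {z : ℂ | Real.log R < z.re} := by
    ext z
    simp only [Set.mem_compl_iff, mem_closedBall_zero_iff, not_le, Set.mem_image, Set.mem_ofPred_eq]
    constructor
    · intro hz
      refine ⟨log z, ?_, exp_log (norm_pos_iff.mp (hR.trans hz))⟩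
      rw [log_re]
      exact Real.log_lt_log hR hz
    · rintro ⟨y, hy, rfl⟩
      rw [norm_exp]
      exact (Real.log_lt_iff_lt_exp hR).mp hy
  rw [h]
  exact (convex_halfSpace_re_gt _).isPreconnected.image _ continuous_exp.continuousOn

theorem IsPreconnected.subset_left_or_right_of_isClosed {X : Type*} [TopologicalSpace X]
    {S A B : Set X} (hS : IsPreconnected S) (hA : IsClosed A) (hB : IsClosed B)
    (hAB : Disjoint A B) (h : S ⊆ A ∪ B) : S ⊆ A ∨ S ⊆ B :=
  isPreconnected_iff_subset_of_disjoint_closed.mp hS A B hA hB h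
    (by rw [hAB.inter_eq, Set.inter_empty])

/-- If `W` is bounded and `E₁ ∪ E₂ = Wᶜ` with `E₁` bounded, then there is no continuous logarithm
of `z - a` on `W` for `a ∈ E₁`. -/
theorem false_of_compl_eq_union {W E₁ E₂ : Set ℂ} (hWo : IsOpen W) (hWb : Bornology.IsBounded W)
    (hE₁ : IsClosed E₁) (hE₂ : IsClosed E₂) (hd : Disjoint E₁ E₂) (hE : Wᶜ = E₁ ∪ E₂)
    (hb : Bornology.IsBounded E₁) {a : ℂ} (ha : a ∈ E₁)
    (hlog : ∃ g : ℂ → ℂ, ContinuousOn g W ∧ ∀ x ∈ W, x - a = exp (g x)) : False := by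
  classical
  obtain ⟨g, hg, hgx⟩ := hlog
  obtain ⟨h, h0, h1, -⟩ := exists_continuous_zero_one_of_isClosed hE₁ hE₂ hd
  set k : ℂ → ℝ := fun z => max 0 (min 1 (3 * h z - 1)) with hk
  have hkc : Continuous k := by fun_prop
  have hk0 : ∀ z, h z < 1 / 3 → k z = 0 := fun z hz =>
    max_eq_left ((min_le_right _ _).trans (by linarith))
  have hk1 : ∀ z, 2 / 3 < h z → k z = 1 := fun z hz => by
    rw [hk]
    simp only
    rw [min_eq_left (by linarith), max_eq_right zero_le_one]
  set F : ℂ → ℂ := fun z =>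
    if z ∈ W then exp (k z * g z) else if h z < 1 / 2 then 1 else z - a with hF
  have hmem : ∀ z ∉ W, z ∈ E₁ ∨ z ∈ E₂ := fun z hz => (Set.ext_iff.mp hE z).mp hz
  have hF0 : ∀ z, h z < 1 / 3 → F z = 1 := fun z hz => by
    by_cases hzW : z ∈ W
    · simp [hF, hzW, hk0 z hz]
    · simp only [hF, hzW, if_false]
      rw [if_pos (by linarith)]
  have hF1 : ∀ z, 2 / 3 < h z → F z = z - a := fun z hz => by
    by_cases hzW : z ∈ W
    · simp [hF, hzW, hk1 z hz, hgx z hzW]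
    · simp only [hF, hzW, if_false]
      rw [if_neg (by linarith)]
  refine not_exists_nonvanishing_extension (F := F) (continuous_iff_continuousAt.mpr fun z => ?_)
    (fun z => ?_) (hWb.union hb) (p := a) fun z hz => ?_
  · by_cases hzW : z ∈ W
    · have hc : ContinuousAt (fun z => exp (k z * g z)) z :=
        ((continuous_ofReal.comp hkc).continuousAt.mul
          (hg.continuousAt (hWo.mem_nhds hzW))).cexp
      refine hc.congr ?_
      filter_upwards [hWo.mem_nhds hzW] with y hy
      simp [hF, hy]
    · rcases hmem z hzW with hz | hz
      · have : ∀ᶠ y in nhds z, h y < 1 / 3 := h.continuous.continuousAt.eventually_lt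
          continuousAt_const (by simp [h0 hz])
        exact (continuousAt_const (y := (1 : ℂ))).congr (this.mono fun y hy => (hF0 y hy).symm)
      · have : ∀ᶠ y in nhds z, 2 / 3 < h y := continuousAt_const.eventually_lt
          h.continuous.continuousAt (by rw [h1 hz]; norm_num)
        exact (continuousAt_id.sub continuousAt_const).congr
          (this.mono fun y hy => (hF1 y hy).symm)
  · by_cases hzW : z ∈ W
    · simp [hF, hzW, exp_ne_zero]
    · rcases hmem z hzW with hz | hz
      · rw [hF0 z (by rw [h0 hz]; norm_num)]
        exact one_ne_zero
      · rw [hF1 z (by rw [h1 hz]; norm_num)]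
        exact sub_ne_zero.mpr fun h => hd.notMem_of_mem_left ha (h ▸ hz)
  · rw [Set.mem_union, not_or] at hz
    have := (hmem z hz.1).resolve_left hz.2
    exact hF1 z (by rw [h1 this]; norm_num)

/-- The complement of a bounded simply connected plane domain is connected. -/
theorem isPreconnected_compl_of_exists_log {W : Set ℂ} (hWo : IsOpen W)
    (hWb : Bornology.IsBounded W)
    (hlog : ∀ a ∉ W, ∃ g : ℂ → ℂ, ContinuousOn g W ∧ ∀ x ∈ W, x - a = exp (g x)) :
    IsPreconnected Wᶜ := by
  rw [isPreconnected_iff_subset_of_fully_disjoint_closed hWo.isClosed_compl]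
  intro A B hA hB hAB hd
  by_contra! hcon
  obtain ⟨⟨b, hbW, hbA⟩, ⟨a, haW, haB⟩⟩ := And.imp Set.not_subset.mp Set.not_subset.mp hcon
  have hbB : b ∈ B := (hAB hbW).resolve_left hbA
  have haA : a ∈ A := (hAB haW).resolve_right haB
  obtain ⟨R, hR, hWR⟩ := hWb.subset_ball_lt 0 0
  have hRW : (Metric.closedBall (0 : ℂ) R)ᶜ ⊆ Wᶜ := Set.compl_subset_compl.mpr
    (hWR.trans Metric.ball_subset_closedBall)
  have hE : Wᶜ = (Wᶜ ∩ A) ∪ (Wᶜ ∩ B) := by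
    rw [← Set.inter_union_distrib_left, Set.inter_eq_left.mpr hAB]
  have key : ∀ C D : Set ℂ, Disjoint C D → (Metric.closedBall (0 : ℂ) R)ᶜ ⊆ D →
      Bornology.IsBounded (Wᶜ ∩ C) := fun C D hCD h => by
    refine (Metric.isBounded_closedBall (x := (0 : ℂ)) (r := R)).subset fun x hx => ?_
    by_contra hxR
    exact hCD.notMem_of_mem_left hx.2 (h hxR)
  have hcA := hWo.isClosed_compl.inter hA
  have hcB := hWo.isClosed_compl.inter hB
  have hdd : Disjoint (Wᶜ ∩ A) (Wᶜ ∩ B) :=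
    hd.mono Set.inter_subset_right Set.inter_subset_right
  rcases (isPreconnected_compl_closedBall_zero hR).subset_left_or_right_of_isClosed hA hB hd
    (hRW.trans hAB) with h | h
  · exact false_of_compl_eq_union hWo hWb hcB hcA hdd.symm (by rw [Set.union_comm, ← hE])
      (key B A hd.symm h) ⟨hbW, hbB⟩ (hlog b hbW)
  · exact false_of_compl_eq_union hWo hWb hcA hcB hdd hE (key A B hd h) ⟨haW, haA⟩ (hlog a haW)

theorem disjoint_frontier_connectedComponentIn {S : Set ℂ} (hS : IsOpen S) (z : ℂ) :
    Disjoint (frontier (connectedComponentIn S z)) S := by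
  rw [Set.disjoint_left]
  intro x hx hxS
  have hVo : IsOpen (connectedComponentIn S z) := hS.connectedComponentIn
  have hx' := hVo.frontier_eq ▸ hx
  obtain ⟨y, hyx, hyz⟩ := mem_closure_iff.mp hx'.1 _ (hS.connectedComponentIn (x := x))
    (mem_connectedComponentIn hxS)
  refine hx'.2 ?_
  rw [connectedComponentIn_eq hyz, ← connectedComponentIn_eq hyx]
  exact mem_connectedComponentIn hxS

theorem IsPreconnected.subset_of_disjoint_frontier {X : Type*} [TopologicalSpace X] {C V : Set X}
    (hC : IsPreconnected C) (hV : IsOpen V) (hd : Disjoint (frontier V) C)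
    (hne : (C ∩ V).Nonempty) : C ⊆ V := by
  refine hC.subset_of_closure_inter_subset hV hne fun x hx => ?_
  by_contra hxV
  exact hd.notMem_of_mem_left (hV.frontier_eq ▸ ⟨hx.1, hxV⟩) hx.2

theorem notMem_closure_connectedComponentIn {S : Set ℂ} (hS : IsOpen S) {z w : ℂ} (hw : w ∈ S)
    (h : w ∉ connectedComponentIn S z) : w ∉ closure (connectedComponentIn S z) := fun hcl =>
  (disjoint_frontier_connectedComponentIn hS z).notMem_of_mem_left
    (hS.connectedComponentIn.frontier_eq ▸ ⟨hcl, h⟩) hw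

section Crosscut

variable {W γ : Set ℂ} {w z : ℂ}

theorem IsCrosscut.subset (h : IsCrosscut W γ) : γ ⊆ W := by
  obtain ⟨g, -, -, rfl, hg, -⟩ := h
  exact hg

theorem IsCrosscut.isPreconnected (h : IsCrosscut W γ) : IsPreconnected γ := by
  obtain ⟨g, hgc, -, rfl, -⟩ := h
  exact isPreconnected_Ioo.image _ (hgc.mono Set.Ioo_subset_Icc_self)

theorem IsCrosscut.exists_closure_eq (h : IsCrosscut W γ) :
    ∃ a ∈ frontier W, ∃ b ∈ frontier W, closure γ = insert a (insert b γ) := by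
  obtain ⟨g, hgc, -, rfl, -, h0, h1⟩ := h
  refine ⟨g 0, h0, g 1, h1, ?_⟩
  have hI : g '' Set.Icc 0 1 = insert (g 0) (insert (g 1) (g '' Set.Ioo 0 1)) := by
    rw [← Set.image_insert_eq, ← Set.image_insert_eq, Set.Ioo_insert_right zero_lt_one,
      Set.Ioc_insert_left zero_le_one]
  rw [← hI]
  refine ((isCompact_Icc.image_of_continuousOn hgc).isClosed.closure_subset_iff.mpr
    (Set.image_mono Set.Ioo_subset_Icc_self)).antisymm ?_
  rw [← closure_Ioo zero_ne_one] at hgc ⊢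
  exact hgc.image_closure

theorem IsCrosscut.compl_union_eq (hWo : IsOpen W) (h : IsCrosscut W γ) :
    Wᶜ ∪ γ = Wᶜ ∪ closure γ := by
  obtain ⟨a, ha, b, hb, hγ⟩ := h.exists_closure_eq
  rw [hWo.frontier_eq] at ha hb
  ext x
  simp only [hγ, Set.mem_union, Set.mem_compl_iff, Set.mem_insert_iff]
  refine or_congr_right' fun hx => ?_
  rw [not_not] at hx
  have h1 : x ≠ a := fun e => ha.2 (e ▸ hx)
  have h2 : x ≠ b := fun e => hb.2 (e ▸ hx)
  simp [h1, h2]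

theorem IsCrosscut.isClosed_compl_union (hWo : IsOpen W) (h : IsCrosscut W γ) :
    IsClosed (Wᶜ ∪ γ) := by
  rw [h.compl_union_eq hWo]
  exact hWo.isClosed_compl.union isClosed_closure

theorem IsCrosscut.isOpen_diff (hWo : IsOpen W) (h : IsCrosscut W γ) : IsOpen (W \ γ) := by
  have := (h.isClosed_compl_union hWo).isOpen_compl
  rwa [Set.compl_union, compl_compl] at this

theorem IsCrosscut.frontier_component_subset (hWo : IsOpen W) (h : IsCrosscut W γ) :
    frontier (connectedComponentIn (W \ γ) z) ⊆ Wᶜ ∪ γ := fun _ hx => by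
  have := (disjoint_frontier_connectedComponentIn (h.isOpen_diff hWo) z).notMem_of_mem_left hx
  by_contra hcon
  rw [Set.mem_union, not_or, Set.mem_compl_iff, not_not] at hcon
  exact this hcon

theorem connectedComponentIn_subset_crosscutNbhd (hz : z ∈ crosscutNbhd W w γ) :
    connectedComponentIn (W \ γ) z ⊆ crosscutNbhd W w γ := fun _ hx =>
  ⟨connectedComponentIn_subset _ _ hx, connectedComponentIn_eq hx ▸ hz.2⟩

theorem crosscutNbhd_subset : crosscutNbhd W w γ ⊆ W := fun _ hx => hx.1.1

theorem IsCrosscut.exists_mem_closure_component (hWo : IsOpen W) (hWc : IsPreconnected W)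
    (hw : w ∈ W) (h : IsCrosscut W γ) (hz : z ∈ crosscutNbhd W w γ) :
    ∃ x ∈ γ, x ∈ closure (connectedComponentIn (W \ γ) z) := by
  by_contra! hcon
  have hS := h.isOpen_diff hWo
  refine hz.2 (hWc.subset_of_disjoint_frontier hS.connectedComponentIn ?_
    ⟨z, hz.1.1, mem_connectedComponentIn hz.1⟩ hw)
  rw [Set.disjoint_left]
  intro x hx hxW
  rcases h.frontier_component_subset hWo hx with hx' | hx'
  · exact hx' hxW
  · exact hcon x hx' (frontier_subset_closure hx)

theorem IsCrosscut.not_hasLogRatio_frontier (hWo : IsOpen W) (hWb : Bornology.IsBounded W)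
    (hw : w ∈ W) (h : IsCrosscut W γ) (hwγ : w ∉ γ) (hz : z ∈ crosscutNbhd W w γ) :
    ¬ HasLogRatio (frontier (connectedComponentIn (W \ γ) z)) z w :=
  _root_.not_hasLogRatio_frontier
    (hWb.subset ((connectedComponentIn_subset _ _).trans Set.sdiff_subset))
    (mem_connectedComponentIn hz.1)
    (notMem_closure_connectedComponentIn (h.isOpen_diff hWo) ⟨hw, hwγ⟩ hz.2)

/-- Points of the crosscut neighborhood are close to the crosscut. -/
theorem IsCrosscut.exists_dist_le_diam (hWo : IsOpen W) (hWb : Bornology.IsBounded W)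
    (hWc : IsPreconnected W) (hw : w ∈ W) (h : IsCrosscut W γ) (hz : z ∈ crosscutNbhd W w γ) :
    ∃ x ∈ γ, ∀ y ∈ closure (crosscutNbhd W w γ),
      dist y x ≤ Metric.diam (crosscutNbhd W w γ) := by
  obtain ⟨x, hx, hxz⟩ := h.exists_mem_closure_component hWo hWc hw hz
  refine ⟨x, hx, fun y hy => ?_⟩
  rw [← Metric.diam_closure]
  exact Metric.dist_le_diam_of_mem (hWb.subset crosscutNbhd_subset).closure hy
    (closure_mono (connectedComponentIn_subset_crosscutNbhd hz) hxz)

theorem hasLogRatio_compl (hWo : IsOpen W) (hWc : IsPreconnected W) {p q : ℂ} (hp : p ∈ W)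
    (hq : q ∈ W) : HasLogRatio Wᶜ p q :=
  hasLogRatio_of_isPreconnected hWo.isClosed_compl hWc disjoint_compl_right hp hq

end Crosscut

theorem exists_isPreconnected_of_dist_lt {F : Set ℂ} (hF : IsCompact F)
    [LocallyConnectedSpace F] {ε : ℝ} (hε : 0 < ε) :
    ∃ δ > 0, ∀ x ∈ F, ∀ y ∈ F, dist x y < δ →
      ∃ L ⊆ F, IsClosed L ∧ IsPreconnected L ∧ x ∈ L ∧ y ∈ L ∧ L ⊆ Metric.closedBall x ε := by
  have : CompactSpace F := isCompact_iff_compactSpace.mp hF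
  have hV : ∀ x : F, ∃ V ⊆ Metric.ball x (ε / 2), IsOpen V ∧ x ∈ V ∧ IsConnected V := fun x =>
    locallyConnectedSpace_iff_subsets_isOpen_isConnected.mp inferInstance x _
      (Metric.ball_mem_nhds x (half_pos hε))
  choose V hVb hVo hxV hVc using hV
  obtain ⟨δ, hδ, h⟩ := lebesgue_number_lemma_of_metric (isCompact_univ (X := F)) hVo
    fun x _ => Set.mem_iUnion.mpr ⟨x, hxV x⟩
  refine ⟨δ, hδ, fun x hx y hy hxy => ?_⟩
  obtain ⟨i, hi⟩ := h ⟨x, hx⟩ (Set.mem_univ _)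
  have hxi : (⟨x, hx⟩ : F) ∈ V i := hi (Metric.mem_ball_self hδ)
  have hyi : (⟨y, hy⟩ : F) ∈ V i := hi (by rwa [Metric.mem_ball, dist_comm])
  refine ⟨Subtype.val '' closure (V i), Subtype.coe_image_subset _ _,
    hF.isClosed.isClosedEmbedding_subtypeVal.isClosedMap _ isClosed_closure,
    (hVc i).isPreconnected.closure.image _ continuous_subtype_val.continuousOn,
    ⟨_, subset_closure hxi, rfl⟩, ⟨_, subset_closure hyi, rfl⟩, ?_⟩
  rintro _ ⟨z, hz, rfl⟩
  have : closure (V i) ⊆ Metric.closedBall ⟨x, hx⟩ ε := by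
    refine closure_minimal (fun u hu => ?_) Metric.isClosed_closedBall
    have h1 := Metric.mem_ball.mp (hVb i hu)
    have h2 := Metric.mem_ball.mp (hVb i hxi)
    rw [Metric.mem_closedBall]
    linarith [dist_triangle_right u ⟨x, hx⟩ i]
  exact this hz

section Forward

variable {W γ : Set ℂ} {w : ℂ}

/-- If the endpoints of a crosscut are joined by a connected part of the complement, then the
crosscut neighborhood is contained in any disk containing the crosscut and this connected set. -/
theorem IsCrosscut.nbhd_subset_closedBall (hWo : IsOpen W) (hWb : Bornology.IsBounded W)
    (hWc : IsPreconnected W) (hw : w ∈ W) (h : IsCrosscut W γ) (hwγ : w ∉ γ) {L : Set ℂ}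
    (hL : IsClosed L) (hLc : IsPreconnected L) (hLW : L ⊆ Wᶜ) (hγL : closure γ ⊆ γ ∪ L) {p : ℂ}
    {r : ℝ} (hγp : closure γ ⊆ Metric.closedBall p r) (hLp : L ⊆ Metric.closedBall p r)
    (hwp : w ∉ Metric.closedBall p r) : crosscutNbhd W w γ ⊆ Metric.closedBall p r := by
  intro z hz
  by_contra hzp
  refine h.not_hasLogRatio_frontier hWo hWb hw hwγ hz ?_
  have hA : HasLogRatio (closure γ ∪ L) z w :=
    (hasLogRatio_of_convex (convex_closedBall p r) Metric.isClosed_closedBall hzp hwp).mono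
      (Set.union_subset hγp hLp)
  have hAE : (closure γ ∪ L) ∩ Wᶜ = L := by
    refine Set.Subset.antisymm ?_ (Set.subset_inter Set.subset_union_right hLW)
    rintro x ⟨hx | hx, hxW⟩
    · exact (hγL hx).resolve_left fun hxγ => hxW (h.subset hxγ)
    · exact hx
  refine (hA.union (isClosed_closure.union hL) hWo.isClosed_compl (by rwa [hAE])
    (fun hw' => hw'.2 hw) (hasLogRatio_compl hWo hWc hz.1.1 hw)).mono
    ((h.frontier_component_subset hWo).trans ?_)
  exact Set.union_subset Set.subset_union_right
    (subset_closure.trans (Set.subset_union_left.trans Set.subset_union_left))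

theorem exists_diam_crosscutNbhd_le (hWo : IsOpen W) (hWb : Bornology.IsBounded W)
    (hWc : IsPreconnected W) (hw : w ∈ W) [LocallyConnectedSpace (frontier W)] {ε : ℝ}
    (hε : 0 < ε) : ∃ δ > 0, ∀ γ, IsCrosscut W γ → w ∉ γ → Metric.diam (closure γ) < δ →
      Metric.diam (crosscutNbhd W w γ) ≤ ε := by
  obtain ⟨ρ, hρ, hρW⟩ := Metric.isOpen_iff.mp hWo w hw
  set r := min (ε / 2) (ρ / 2) with hr
  have hr0 : 0 < r := lt_min (half_pos hε) (half_pos hρ)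
  have hcpt : IsCompact (frontier W) :=
    Metric.isCompact_of_isClosed_isBounded isClosed_frontier
      (hWb.closure.subset frontier_subset_closure)
  obtain ⟨δ, hδ, hL⟩ := exists_isPreconnected_of_dist_lt hcpt hr0
  refine ⟨min δ r, lt_min hδ hr0, fun γ hγ hwγ hd => ?_⟩
  obtain ⟨a, ha, b, hb, hab⟩ := hγ.exists_closure_eq
  have hbdd : Bornology.IsBounded (closure γ) := (hWb.subset hγ.subset).closure
  have haγ : a ∈ closure γ := by simp [hab]
  have hbγ : b ∈ closure γ := by simp [hab]
  obtain ⟨L, hLF, hLc, hLp, haL, hbL, hLb⟩ := hL a ha b hb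
    ((Metric.dist_le_diam_of_mem hbdd haγ hbγ).trans_lt (hd.trans_le (min_le_left _ _)))
  have hFE : frontier W ⊆ Wᶜ := fun x hx => (hWo.frontier_eq ▸ hx).2
  have hsub : crosscutNbhd W w γ ⊆ Metric.closedBall a r := by
    refine hγ.nbhd_subset_closedBall hWo hWb hWc hw hwγ hLc hLp (hLF.trans hFE) ?_
      (fun x hx => ?_) hLb fun hwa => hFE ha (hρW ?_)
    · rw [hab]
      rintro x (rfl | rfl | hx)
      exacts [.inr haL, .inr hbL, .inl hx]
    · exact (Metric.dist_le_diam_of_mem hbdd hx haγ).trans (hd.le.trans (min_le_right _ _))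
    · rw [Metric.mem_ball, dist_comm]
      exact (Metric.mem_closedBall.mp hwa).trans_lt ((min_le_right _ _).trans_lt (half_lt_self hρ))
  calc _ ≤ Metric.diam (Metric.closedBall a r) := Metric.diam_mono hsub
        Metric.isBounded_closedBall
    _ ≤ 2 * r := Metric.diam_closedBall hr0.le
    _ ≤ ε := by linarith [min_le_left (ε / 2) (ρ / 2)]

theorem exists_isCaratheodoryModulus (hWb : Bornology.IsBounded W)
    (h : ∀ ε > 0, ∃ δ > 0, ∀ γ, IsCrosscut W γ → w ∉ γ → Metric.diam (closure γ) < δ →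
      Metric.diam (crosscutNbhd W w γ) ≤ ε) :
    ∃ η : ℝ → ℝ, IsCaratheodoryModulus W w 1 η ∧
        Filter.Tendsto η (nhdsWithin 0 (Set.Ioi 0)) (nhds 0) := by
  set D : ℝ → Set ℝ := fun r => insert 0 {d | ∃ γ, IsCrosscut W γ ∧ w ∉ γ ∧
    Metric.diam (closure γ) < r ∧ d = Metric.diam (crosscutNbhd W w γ)} with hD
  have hbdd : ∀ r, BddAbove (D r) := fun r => by
    refine ⟨Metric.diam W, ?_⟩
    rintro _ (rfl | ⟨γ, -, -, -, rfl⟩)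
    · exact Metric.diam_nonneg
    · exact Metric.diam_mono crosscutNbhd_subset hWb
  have hmono : ∀ r s, r ≤ s → D r ⊆ D s := fun r s hrs =>
    Set.insert_subset_insert fun d ⟨γ, h1, h2, h3, h4⟩ => ⟨γ, h1, h2, h3.trans_le hrs, h4⟩
  have hne : ∀ r, (D r).Nonempty := fun r => ⟨0, Set.mem_insert _ _⟩
  refine ⟨fun r => sSup (D r) + r, ⟨fun r _ s _ hrs => ?_, fun γ hγ hwγ r hr _ => ?_⟩, ?_⟩
  · exact add_lt_add_of_le_of_lt (csSup_le_csSup (hbdd s) (hne r) (hmono r s hrs.le)) hrs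
  · have : Metric.diam (crosscutNbhd W w γ) ≤ sSup (D r) :=
      le_csSup (hbdd r) (.inr ⟨γ, hγ, hwγ, hr, rfl⟩)
    linarith [Metric.diam_nonneg (s := closure γ)]
  · rw [Metric.tendsto_nhdsWithin_nhds]
    intro ε hε
    obtain ⟨δ, hδ, hδε⟩ := h (ε / 2) (half_pos hε)
    refine ⟨min δ (ε / 2), lt_min hδ (half_pos hε), fun {r} hr hrd => ?_⟩
    rw [Set.mem_Ioi] at hr
    rw [Real.dist_eq, sub_zero, abs_of_pos hr, lt_min_iff] at hrd
    have h0 : 0 ≤ sSup (D r) := le_csSup (hbdd r) (Set.mem_insert _ _)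
    have h1 : sSup (D r) ≤ ε / 2 := by
      refine csSup_le (hne r) ?_
      rintro _ (rfl | ⟨γ, h1, h2, h3, rfl⟩)
      · exact (half_pos hε).le
      · exact hδε γ h1 h2 (h3.trans hrd.1)
    rw [Real.dist_eq, sub_zero, abs_of_nonneg (by linarith)]
    linarith

end Forward

section Segment

variable {W : Set ℂ} {w a b : ℂ}

theorem isCrosscut_openSegment (hab : a ≠ b) (ha : a ∈ frontier W) (hb : b ∈ frontier W)
    (h : openSegment ℝ a b ⊆ W) : IsCrosscut W (openSegment ℝ a b) := by
  refine ⟨AffineMap.lineMap a b, (AffineMap.lineMap_continuous).continuousOn,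
    (AffineMap.lineMap_injective ℝ hab).injOn, openSegment_eq_image_lineMap ℝ a b, ?_, ?_, ?_⟩
  · rwa [← openSegment_eq_image_lineMap]
  · rwa [AffineMap.lineMap_apply_zero]
  · rwa [AffineMap.lineMap_apply_one]

theorem mem_segment_of_div_notMem_slitPlane {x : ℂ} (hxb : x ≠ b)
    (h : (x - a) / (x - b) ∉ slitPlane) : x ∈ segment ℝ a b := by
  rw [mem_slitPlane_iff, not_or, not_lt, not_not] at h
  obtain ⟨h1, h2⟩ := h
  set t := -((x - a) / (x - b)).re with ht
  have hteq : x - a = -(t : ℂ) * (x - b) := by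
    rw [← div_eq_iff (sub_ne_zero.mpr hxb)]
    apply Complex.ext <;> simp [ht, h2]
  have ht0 : 0 < 1 + t := by linarith
  refine ⟨1 / (1 + t), t / (1 + t), by positivity, div_nonneg (by linarith) ht0.le,
    by field_simp, ?_⟩
  have : (1 + (t : ℂ)) ≠ 0 := by exact_mod_cast ht0.ne'
  simp only [real_smul]
  push_cast
  field_simp
  linear_combination -hteq

theorem lineMap_half_add_notMem_openSegment (hab : a ≠ b) {τ : ℝ} (hτ : τ ≠ 0) :
    (a + b) / 2 + τ * I * (b - a) ∉ openSegment ℝ a b := by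
  rw [openSegment_eq_image_lineMap]
  rintro ⟨t, -, ht⟩
  rw [AffineMap.lineMap_apply_module'] at ht
  have hne : b - a ≠ 0 := sub_ne_zero.mpr hab.symm
  have : ((t : ℂ) - 1 / 2 - τ * I) = 0 := by
    refine (mul_eq_zero.mp ?_).resolve_right hne
    rw [real_smul] at ht
    linear_combination ht
  exact hτ (by simpa using congrArg im this)

theorem tendsto_ratio_nhds_zero (hab : a ≠ b) {s : ℝ} :
    Filter.Tendsto (fun τ : ℝ => ((a + b) / 2 + (s * τ : ℝ) * I * (b - a) - a) /
      ((a + b) / 2 + (s * τ : ℝ) * I * (b - a) - b)) (nhds 0) (nhds (-1)) := by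
  have hne : b - a ≠ 0 := sub_ne_zero.mpr hab.symm
  have hc : ContinuousAt (fun τ : ℝ => ((a + b) / 2 + (s * τ : ℝ) * I * (b - a) - a) /
      ((a + b) / 2 + (s * τ : ℝ) * I * (b - a) - b)) 0 := by
    refine ContinuousAt.div (by fun_prop) (by fun_prop) ?_
    have : (a + b) / 2 + (s * 0 : ℝ) * I * (b - a) - b = -(b - a) / 2 := by
      push_cast; ring
    rw [this]
    exact div_ne_zero (neg_ne_zero.mpr hne) two_ne_zero
  convert hc.tendsto using 2
  push_cast
  rw [mul_zero, zero_mul, zero_mul, add_zero, eq_div_iff]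
  · ring
  · rw [show (a + b) / 2 - b = -(b - a) / 2 by ring]
    exact div_ne_zero (neg_ne_zero.mpr hne) two_ne_zero

theorem im_ratio (hab : a ≠ b) (τ : ℝ) :
    (((a + b) / 2 + τ * I * (b - a) - a) / ((a + b) / 2 + τ * I * (b - a) - b)).im =
      -τ / (1 / 4 + τ ^ 2) := by
  have hne : b - a ≠ 0 := sub_ne_zero.mpr hab.symm
  have h1 : ((a + b) / 2 + τ * I * (b - a) - a) / ((a + b) / 2 + τ * I * (b - a) - b) =
      (1 / 2 + τ * I) / (-1 / 2 + τ * I) := by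
    rw [← mul_div_mul_left (1 / 2 + τ * I) (-1 / 2 + τ * I) hne]
    congr 1 <;> ring
  rw [h1, div_im]
  have : normSq (-1 / 2 + τ * I) = 1 / 4 + τ ^ 2 := by
    simp [normSq_apply]
    norm_num
    ring
  rw [this]
  simp
  norm_num
  ring

/-- A segment crosscut separates the domain. -/
theorem nonempty_crosscutNbhd_openSegment (hWo : IsOpen W)
    (hlog : ∀ a ∉ W, ∃ g : ℂ → ℂ, ContinuousOn g W ∧ ∀ x ∈ W, x - a = exp (g x))
    (hab : a ≠ b) (ha : a ∉ W) (hb : b ∉ W) (h : openSegment ℝ a b ⊆ W) :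
    (crosscutNbhd W w (openSegment ℝ a b)).Nonempty := by
  by_contra hN
  rw [Set.not_nonempty_iff_eq_empty] at hN
  set S := W \ openSegment ℝ a b with hS
  have hcon : ∀ z ∈ S, w ∈ connectedComponentIn S z := fun z hz => by
    by_contra hcon
    exact (hN ▸ (⟨hz, hcon⟩ : z ∈ crosscutNbhd W w (openSegment ℝ a b)) : z ∈ (∅ : Set ℂ))
  have hSc : IsPreconnected S := by
    have : connectedComponentIn S w = S := by
      refine (connectedComponentIn_subset _ _).antisymm fun z hz => ?_
      rw [← connectedComponentIn_eq (hcon z hz)]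
      exact mem_connectedComponentIn hz
    rw [← this]
    exact isPreconnected_connectedComponentIn
  obtain ⟨g, hg, hgx⟩ := hasLogRatio_of_exists_log (hlog a ha) (hlog b hb)
  have hxa : ∀ x ∈ W, x - a ≠ 0 := fun x hx => sub_ne_zero.mpr fun e => ha (e ▸ hx)
  have hxb : ∀ x ∈ W, x - b ≠ 0 := fun x hx => sub_ne_zero.mpr fun e => hb (e ▸ hx)
  have hslit : ∀ x ∈ S, (x - a) / (x - b) ∈ slitPlane := fun x hx => by
    by_contra hcon
    have hseg := mem_segment_of_div_notMem_slitPlane (sub_ne_zero.mp (hxb x hx.1)) hcon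
    rw [← insert_endpoints_openSegment] at hseg
    rcases hseg with rfl | rfl | hseg
    exacts [ha hx.1, hb hx.1, hx.2 hseg]
  have hconst : ∀ x ∈ S, ∀ y ∈ S, g x - log ((x - a) / (x - b)) = g y - log ((y - a) / (y - b)) :=
    fun x hx y hy => by
    refine hSc.eq_of_exp_eq_one (h := fun x => g x - log ((x - a) / (x - b))) ?_ ?_ hx hy
    · refine (hg.mono Set.sdiff_subset).sub (ContinuousOn.clog (ContinuousOn.div (by fun_prop)
        (by fun_prop) fun x hx => hxb x hx.1) hslit)
    · intro x hx
      rw [exp_sub, exp_log (slitPlane_ne_zero (hslit x hx)), hgx x hx.1,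
        mul_div_cancel_right₀ _ (hxb x hx.1), div_self (exp_ne_zero _)]
  have hm : (a + b) / 2 ∈ W := by
    refine h ⟨1 / 2, 1 / 2, by norm_num, by norm_num, by norm_num, ?_⟩
    simp only [real_smul]
    push_cast
    ring
  have hφ : ∀ s : ℝ, Filter.Tendsto (fun τ : ℝ => (a + b) / 2 + (s * τ : ℝ) * I * (b - a))
      (nhds 0) (nhds ((a + b) / 2)) := fun s => by
    have : Continuous fun τ : ℝ => (a + b) / 2 + (s * τ : ℝ) * I * (b - a) := by fun_prop
    simpa using this.tendsto 0
  have hφS : ∀ s : ℝ, s ≠ 0 → ∀ᶠ τ : ℝ in nhdsWithin 0 (Set.Ioi 0),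
      (a + b) / 2 + (s * τ : ℝ) * I * (b - a) ∈ S := fun s hs => by
    filter_upwards [nhdsWithin_le_nhds ((hφ s).eventually (hWo.mem_nhds hm)),
      self_mem_nhdsWithin] with τ hτ hτ0
    exact ⟨hτ, lineMap_half_add_notMem_openSegment hab
      (mul_ne_zero hs (ne_of_gt (Set.mem_Ioi.mp hτ0)))⟩
  have hlim : ∀ s : ℝ, Filter.Tendsto
      (fun τ : ℝ => g ((a + b) / 2 + (s * τ : ℝ) * I * (b - a))) (nhdsWithin 0 (Set.Ioi 0))
      (nhds (g ((a + b) / 2))) := fun s =>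
    (hg.continuousAt (hWo.mem_nhds hm)).tendsto.comp ((hφ s).mono_left nhdsWithin_le_nhds)
  have hL1 := (tendsto_log_nhdsWithin_im_neg_of_re_neg_of_im_zero (z := -1) (by simp)
    (by simp)).comp (f := fun τ : ℝ => ((a + b) / 2 + (1 * τ : ℝ) * I * (b - a) - a) /
      ((a + b) / 2 + (1 * τ : ℝ) * I * (b - a) - b)) (x := nhdsWithin 0 (Set.Ioi 0))
      (tendsto_nhdsWithin_iff.mpr ⟨(tendsto_ratio_nhds_zero hab).mono_left nhdsWithin_le_nhds,
        by
          filter_upwards [self_mem_nhdsWithin] with τ hτ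
          rw [Set.mem_Ioi] at hτ
          rw [im_ratio hab]
          exact div_neg_of_neg_of_pos (by linarith) (by positivity)⟩)
  have hL2 := (tendsto_log_nhdsWithin_im_nonneg_of_re_neg_of_im_zero (z := -1) (by simp)
    (by simp)).comp (f := fun τ : ℝ => ((a + b) / 2 + (-1 * τ : ℝ) * I * (b - a) - a) /
      ((a + b) / 2 + (-1 * τ : ℝ) * I * (b - a) - b)) (x := nhdsWithin 0 (Set.Ioi 0))
      (tendsto_nhdsWithin_iff.mpr ⟨(tendsto_ratio_nhds_zero hab).mono_left nhdsWithin_le_nhds,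
        by
          filter_upwards [self_mem_nhdsWithin] with τ hτ
          rw [Set.mem_Ioi] at hτ
          rw [im_ratio hab]
          exact div_nonneg (by linarith) (by positivity)⟩)
  have hu : g ((a + b) / 2) - (Real.log ‖(-1 : ℂ)‖ - Real.pi * I) =
      g ((a + b) / 2) - (Real.log ‖(-1 : ℂ)‖ + Real.pi * I) := by
    refine tendsto_nhds_unique_of_eventuallyEq ((hlim 1).sub hL1) ((hlim (-1)).sub hL2) ?_
    filter_upwards [hφS 1 one_ne_zero, hφS (-1) (by norm_num)] with τ h1 h2
    exact hconst _ h1 _ h2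
  have : (Real.pi : ℂ) * I = 0 := by linear_combination hu / 2
  simp [Real.pi_ne_zero] at this

/-- The part of the boundary adherent to the neighborhood of a segment crosscut connects the
endpoints of the crosscut. -/
theorem not_separated_of_openSegment (hWo : IsOpen W) (hWb : Bornology.IsBounded W)
    (hWc : IsPreconnected W) (hw : w ∈ W) (hab : a ≠ b)
    (h : IsCrosscut W (openSegment ℝ a b)) (hwγ : w ∉ openSegment ℝ a b) {z : ℂ}
    (hz : z ∈ crosscutNbhd W w (openSegment ℝ a b)) {P Q : Set ℂ} (hP : IsClosed P)
    (hQ : IsClosed Q) (hPW : P ⊆ Wᶜ) (hQW : Q ⊆ Wᶜ) (ha : a ∈ P) (hb : b ∈ Q)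
    (hPQ : Wᶜ ∩ closure (crosscutNbhd W w (openSegment ℝ a b)) ⊆ P ∪ Q) :
    ¬ Disjoint P Q := by
  intro hd
  set l : ℝ → ℂ := ⇑(AffineMap.lineMap (k := ℝ) a b) with hl
  have hlc : Continuous l := AffineMap.lineMap_continuous
  have hli : Function.Injective l := AffineMap.lineMap_injective ℝ hab
  have hγ : openSegment ℝ a b = l '' Set.Ioo 0 1 := openSegment_eq_image_lineMap ℝ a b
  have hla : l 0 = a := AffineMap.lineMap_apply_zero a b
  have hlb : l 1 = b := AffineMap.lineMap_apply_one a b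
  have hin : ∀ t, 0 < t → t < 1 → l t ∈ W := fun t h0 h1 => h.subset (hγ ▸ ⟨t, ⟨h0, h1⟩, rfl⟩)
  set A := l '' Set.Icc 0 (1 / 2) with hA
  set B := l '' Set.Icc (1 / 2) 1 with hB
  have hAcl : IsClosed A := (isCompact_Icc.image hlc).isClosed
  have hBcl : IsClosed B := (isCompact_Icc.image hlc).isClosed
  have hAW : ∀ x ∈ A, x ∉ W → x = a := by
    rintro _ ⟨t, ht, rfl⟩ hx
    rcases ht.1.eq_or_lt with h0 | h0
    · rw [← h0, hla]
    · exact absurd (hin t h0 (by linarith [ht.2])) hx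
  have hBW : ∀ x ∈ B, x ∉ W → x = b := by
    rintro _ ⟨t, ht, rfl⟩ hx
    rcases ht.2.eq_or_lt with h0 | h0
    · rw [h0, hlb]
    · exact absurd (hin t (by linarith [ht.1]) h0) hx
  have hnA : ∀ x ∈ W, x ∉ openSegment ℝ a b → x ∉ A := by
    rintro _ hx hxγ ⟨t, ht, rfl⟩
    rcases ht.1.eq_or_lt with h0 | h0
    · exact hPW ha (by rwa [← hla, h0])
    · exact hxγ (hγ ▸ ⟨t, ⟨h0, by linarith [ht.2]⟩, rfl⟩)
  have hnB : ∀ x ∈ W, x ∉ openSegment ℝ a b → x ∉ B := by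
    rintro _ hx hxγ ⟨t, ht, rfl⟩
    rcases ht.2.eq_or_lt with h0 | h0
    · exact hQW hb (by rwa [← hlb, ← h0])
    · exact hxγ (hγ ▸ ⟨t, ⟨by linarith [ht.1], h0⟩, rfl⟩)
  have hEc := hasLogRatio_compl hWo hWc hz.1.1 hw
  have hEA : HasLogRatio (Wᶜ ∪ A) z w := by
    refine hEc.union hWo.isClosed_compl hAcl ?_ (fun h => h.1 hw)
      (hasLogRatio_of_convex ((convex_Icc _ _).affine_image (AffineMap.lineMap a b)) hAcl
        (hnA z hz.1.1 hz.1.2) (hnA w hw hwγ))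
    exact Set.Subsingleton.isPreconnected fun x hx y hy =>
      (hAW x hx.2 hx.1).trans (hAW y hy.2 hy.1).symm
  have hEB : HasLogRatio (Wᶜ ∪ B) z w := by
    refine hEc.union hWo.isClosed_compl hBcl ?_ (fun h => h.1 hw)
      (hasLogRatio_of_convex ((convex_Icc _ _).affine_image (AffineMap.lineMap a b)) hBcl
        (hnB z hz.1.1 hz.1.2) (hnB w hw hwγ))
    exact Set.Subsingleton.isPreconnected fun x hx y hy =>
      (hBW x hx.2 hx.1).trans (hBW y hy.2 hy.1).symm
  have hint : ∀ x ∈ (P ∪ A) ∩ (Q ∪ B), x = l (1 / 2) := by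
    rintro x ⟨hx | hx, hx' | hx'⟩
    · exact absurd hx' (hd.notMem_of_mem_left hx)
    · exact absurd hx (hBW x hx' (hPW hx) ▸ hd.notMem_of_mem_right hb)
    · exact absurd hx' (hAW x hx (hQW hx') ▸ hd.notMem_of_mem_left ha)
    · obtain ⟨t, ht, rfl⟩ := hx
      obtain ⟨s, hs, hst⟩ := hx'
      obtain rfl := hli hst
      rw [le_antisymm ht.2 hs.1]
  have hfin : HasLogRatio ((P ∪ A) ∪ (Q ∪ B)) z w := by
    refine (hEA.mono (Set.union_subset_union_left _ hPW)).union (hP.union hAcl) (hQ.union hBcl)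
      (Set.Subsingleton.isPreconnected fun x hx y hy => (hint x hx).trans (hint y hy).symm)
      (fun h => ?_) (hEB.mono (Set.union_subset_union_left _ hQW))
    exact h.1.elim (fun h' => hPW h' hw) (hnA w hw hwγ)
  refine h.not_hasLogRatio_frontier hWo hWb hw hwγ hz (hfin.mono fun x hx => ?_)
  rcases h.frontier_component_subset hWo hx with hx' | hx'
  · rcases hPQ ⟨hx', closure_mono (connectedComponentIn_subset_crosscutNbhd hz)
      (frontier_subset_closure hx)⟩ with h1 | h1
    exacts [.inl (.inl h1), .inr (.inl h1)]
  · rw [hγ] at hx'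
    obtain ⟨t, ht, rfl⟩ := hx'
    rcases le_total t (1 / 2) with h1 | h1
    exacts [.inl (.inr ⟨t, ⟨ht.1.le, h1⟩, rfl⟩), .inr (.inr ⟨t, ⟨h1, ht.2.le⟩, rfl⟩)]

end Segment

/-- An induction principle along a compact subset of an interval. -/
theorem IsCompact.induction_of_gaps {Z : Set ℝ} (hZ : IsCompact Z) {a b : ℝ} (ha : IsLeast Z a)
    (hb : IsGreatest Z b) {L : ℝ → ℝ → Prop}
    (htrans : ∀ s ∈ Z, ∀ t ∈ Z, ∀ r ∈ Z, s ≤ t → t ≤ r → L s t → L t r → L s r)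
    (hloc : ∀ T ∈ Z, ∃ ε > 0, ∀ s t, T - ε < s → s ≤ t → t < T + ε → L s t)
    (hgap : ∀ s ∈ Z, ∀ t ∈ Z, s < t → Disjoint (Set.Ioo s t) Z → L s t) : L a b := by
  set G := {τ | τ ∈ Z ∧ L a τ} with hG
  have hGa : a ∈ G := by
    obtain ⟨ε, hε, h⟩ := hloc a ha.1
    exact ⟨ha.1, h a a (by linarith) le_rfl (by linarith)⟩
  have hGZ : G ⊆ Z := fun τ hτ => hτ.1
  have hGb : BddAbove G := ⟨b, fun τ hτ => hb.2 (hGZ hτ)⟩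
  set T := sSup G with hT
  have hTZ : T ∈ Z := hZ.isClosed.closure_subset_iff.mpr hGZ (csSup_mem_closure ⟨a, hGa⟩ hGb)
  obtain ⟨ε, hε, hTε⟩ := hloc T hTZ
  have hTG : T ∈ G := by
    obtain ⟨τ, hτ, hτT⟩ := exists_lt_of_lt_csSup ⟨a, hGa⟩ (sub_lt_self T hε)
    have hle := le_csSup hGb hτ
    exact ⟨hTZ, htrans a ha.1 τ hτ.1 T hTZ (ha.2 hτ.1) hle hτ.2
      (hTε τ T hτT hle (by linarith))⟩
  rcases (hb.2 hTZ).eq_or_lt with h | h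
  · exact h ▸ hTG.2
  exfalso
  have hnext : ∀ τ ∈ Z, T < τ → ¬ L T τ := fun τ hτ hlt hL =>
    hlt.not_ge (le_csSup hGb ⟨hτ, htrans a ha.1 T hTZ τ hτ (ha.2 hTZ) hlt.le hTG.2 hL⟩)
  have hnear : ∀ τ ∈ Z, T < τ → T + ε ≤ τ := fun τ hτ hlt => by
    by_contra! hcon
    exact hnext τ hτ hlt (hTε T τ (by linarith) hlt.le hcon)
  obtain ⟨T', hT'⟩ := (hZ.inter_right (isClosed_Ici (a := T + ε))).exists_isLeast
    ⟨b, hb.1, hnear b hb.1 h⟩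
  have hlt : T < T' := lt_of_lt_of_le (by linarith) hT'.1.2
  refine hnext T' hT'.1.1 hlt (hgap T hTZ T' hT'.1.1 hlt ?_)
  rw [Set.disjoint_left]
  exact fun τ hτ hτZ => hτ.2.not_ge (hT'.2 ⟨hτZ, hnear τ hτZ hτ.1⟩)

theorem exists_finite_net {R h : ℝ} (hh : 0 < h) :
    ∃ F : Set ℝ, F.Finite ∧ ∀ s t, 0 ≤ s → t ≤ R → s + h < t → ∃ x ∈ F, x ∈ Set.Ioo s t := by
  refine ⟨(fun k : ℕ => k * h) '' Set.Iic ⌈R / h⌉₊, (Set.finite_Iic _).image _,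
    fun s t hs ht hst => ?_⟩
  have h1 : s / h < (⌊s / h⌋₊ + 1 : ℕ) := by exact_mod_cast Nat.lt_floor_add_one (s / h)
  have h2 : (⌊s / h⌋₊ : ℝ) ≤ s / h := Nat.floor_le (by positivity)
  rw [div_lt_iff₀ hh] at h1
  rw [le_div_iff₀ hh] at h2
  have h3 : ((⌊s / h⌋₊ + 1 : ℕ) : ℝ) * h < t := by
    push_cast
    linarith
  refine ⟨_, ⟨⌊s / h⌋₊ + 1, ?_, rfl⟩, h1, h3⟩
  rw [Set.mem_Iic]
  refine Nat.cast_le (α := ℝ).mp (le_trans ?_ (Nat.le_ceil _))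
  rw [le_div_iff₀ hh]
  linarith

section Circle

variable {W : Set ℂ} {w p u : ℂ}

theorem dist_circleMap_le {ρ : ℝ} (hρ : 0 ≤ ρ) (x y : ℝ) :
    dist (circleMap p ρ x) (circleMap p ρ y) ≤ ρ * |x - y| := by
  have := (lipschitzWith_circleMap p ρ).dist_le_mul x y
  simpa [abs_of_nonneg hρ, Real.dist_eq] using this

theorem isCrosscut_circleMap {ρ s t : ℝ} (hρ : ρ ≠ 0) (hst : s < t) (h2π : t - s < 2 * Real.pi)
    (hs : circleMap p ρ s ∈ frontier W) (ht : circleMap p ρ t ∈ frontier W)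
    (h : circleMap p ρ '' Set.Ioo s t ⊆ W) : IsCrosscut W (circleMap p ρ '' Set.Ioo s t) := by
  have hIoo : (fun x : ℝ => (t - s) * x + s) '' Set.Ioo 0 1 = Set.Ioo s t := by
    have := Set.image_affine_Ioo (sub_pos.mpr hst) s 0 1
    simpa using this
  have himg : circleMap p ρ '' Set.Ioo s t =
      (fun x : ℝ => circleMap p ρ ((t - s) * x + s)) '' Set.Ioo 0 1 := by
    rw [← hIoo, Set.image_image]
  refine ⟨fun x => circleMap p ρ ((t - s) * x + s), ?_, fun x hx y hy hxy => ?_, himg,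
    himg ▸ h, by simpa using hs, by simpa using ht⟩
  · exact ((continuous_circleMap p ρ).comp (by fun_prop)).continuousOn
  · have hts : 0 < t - s := sub_pos.mpr hst
    have := eq_of_circleMap_eq hρ ?_ hxy
    · simpa [hts.ne'] using this
    · rw [add_sub_add_right_eq_sub, ← mul_sub, abs_mul, abs_of_pos hts]
      have : |x - y| ≤ 1 := by
        rw [abs_le]
        constructor <;> linarith [hx.1, hx.2, hy.1, hy.2]
      nlinarith

theorem isClosed_compl_union_inter_component {B Q : Set ℂ} (hWo : IsOpen W) (hB : IsOpen B)
    (hQ : IsClosed Q) (hQB : Q ⊆ B) :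
    IsClosed (Wᶜ ∪ Q ∩ connectedComponentIn (W ∩ B) u) := by
  have : Wᶜ ∪ Q ∩ connectedComponentIn (W ∩ B) u =
      Wᶜ ∪ Q ∩ closure (connectedComponentIn (W ∩ B) u) := by
    refine Set.Subset.antisymm
      (Set.union_subset_union_right _ (Set.inter_subset_inter_right _ subset_closure)) ?_
    rintro x (hx | ⟨hxQ, hx⟩)
    · exact .inl hx
    · by_cases hxW : x ∈ W
      · refine .inr ⟨hxQ, ?_⟩
        by_contra hcon
        exact (disjoint_frontier_connectedComponentIn (hWo.inter hB) u).notMem_of_mem_left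
          ((hWo.inter hB).connectedComponentIn.frontier_eq ▸ ⟨hx, hcon⟩) ⟨hxW, hQB hxQ⟩
      · exact .inl hxW
  rw [this]
  exact hWo.isClosed_compl.union (hQ.inter isClosed_closure)

theorem exists_isCompact_isPreconnected (hWo : IsOpen W) (hWc : IsConnected W) (hu : u ∈ W)
    (hw : w ∈ W) : ∃ σ ⊆ W, IsCompact σ ∧ IsPreconnected σ ∧ u ∈ σ ∧ w ∈ σ := by
  have h := (hWo.isConnected_iff_isPathConnected.mp hWc).joinedIn u hu w hw
  refine ⟨Set.range h.somePath, ?_, isCompact_range h.somePath.continuous,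
    isPreconnected_range h.somePath.continuous, ⟨0, h.somePath.source⟩, ⟨1, h.somePath.target⟩⟩
  rintro _ ⟨t, rfl⟩
  exact h.somePath_mem t

/-- Near the circle parameters outside a component of `W ∩ B`, the part of the circle in this
component does not separate `u` and `w`. -/
theorem exists_hasLogRatio_circleMap_near (hWo : IsOpen W) (hWc : IsConnected W) (hu : u ∈ W)
    (hw : w ∈ W) {B : Set ℂ} (hB : IsOpen B) {ρ T : ℝ}
    (hcB : ∀ t, circleMap p ρ t ∈ B) (hT : circleMap p ρ T ∉ connectedComponentIn (W ∩ B) u) :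
    ∃ ε > 0, ∀ s t, T - ε < s → s ≤ t → t < T + ε → HasLogRatio
      (Wᶜ ∪ circleMap p ρ '' Set.Icc s t ∩ connectedComponentIn (W ∩ B) u) u w := by
  set c := circleMap p ρ with hc
  have hcc : Continuous c := continuous_circleMap p ρ
  have hcl : ∀ s t, IsClosed (c '' Set.Icc s t) := fun s t => (isCompact_Icc.image hcc).isClosed
  have hcB' : ∀ s t, c '' Set.Icc s t ⊆ B := fun s t => by
    rintro _ ⟨x, -, rfl⟩
    exact hcB x
  have hmem : ∀ ε s t x, T - ε < s → t < T + ε → x ∈ Set.Icc s t → dist x T < ε :=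
    fun ε s t x hs ht hx => by
    rw [Real.dist_eq, abs_lt]
    constructor <;> linarith [hx.1, hx.2]
  by_cases hTW : c T ∈ W
  · have hU := (isClosed_compl_union_inter_component (u := u) hWo hB (hcl (T - 1) (T + 1))
      (hcB' _ _)).isOpen_compl
    have hTU : c T ∈ (Wᶜ ∪ c '' Set.Icc (T - 1) (T + 1) ∩
        connectedComponentIn (W ∩ B) u)ᶜ := by
      rintro (h | h)
      exacts [h hTW, hT h.2]
    obtain ⟨ε, hε, hεU⟩ := Metric.eventually_nhds_iff.mp
      (hcc.continuousAt.eventually (hU.mem_nhds hTU))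
    refine ⟨min ε 1, lt_min hε one_pos, fun s t hs _ ht =>
      (hasLogRatio_compl hWo hWc.isPreconnected hu hw).mono ?_⟩
    refine Set.union_subset subset_rfl ?_
    rintro _ ⟨⟨x, hx, rfl⟩, hxO⟩
    have hxT := hmem _ s t x hs ht hx
    have h1 : |x - T| < 1 := hxT.trans_le (min_le_right _ _)
    rw [abs_lt] at h1
    exact absurd (.inr ⟨⟨x, ⟨by linarith [h1.1], by linarith [h1.2]⟩, rfl⟩, hxO⟩)
      (hεU (hxT.trans_le (min_le_left _ _)))
  · obtain ⟨σ, hσW, hσ, hσc, huσ, hwσ⟩ := exists_isCompact_isPreconnected hWo hWc hu hw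
    obtain ⟨ε, hε, hεU⟩ := Metric.eventually_nhds_iff.mp
      (hcc.continuousAt.eventually (hσ.isClosed.isOpen_compl.mem_nhds fun h => hTW (hσW h)))
    refine ⟨ε, hε, fun s t hs _ ht => ?_⟩
    refine (hasLogRatio_of_isPreconnected (hWo.isClosed_compl.union (hcl s t)) hσc ?_ huσ
      hwσ).mono (Set.union_subset_union_right _ Set.inter_subset_left)
    rw [Set.disjoint_union_right]
    refine ⟨Set.disjoint_left.mpr fun x hx hx' => hx' (hσW hx), Set.disjoint_right.mpr ?_⟩
    rintro _ ⟨x, hx, rfl⟩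
    exact hεU (hmem _ s t x hs ht hx)

/-- The part of a circle contained in a component of `W ∩ ball p δ` does not separate `u` from `w`
if all its arcs bound small crosscut neighborhoods. -/
theorem hasLogRatio_circleMap_of_gaps (hWo : IsOpen W) (hWb : Bornology.IsBounded W)
    (hWc : IsConnected W) (hE : IsPreconnected Wᶜ) (hw : w ∈ W) {δ h : ℝ} (hδ : 0 < δ)
    (hwp : δ ≤ dist w p) (hu : u ∈ W ∩ Metric.ball p (δ / 4)) (h2π : h < 2 * Real.pi)
    (hsmall : ∀ γ, IsCrosscut W γ → w ∉ γ → Metric.diam (closure γ) ≤ δ / 2 * h →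
      Metric.diam (crosscutNbhd W w γ) < δ / 4)
    (h0 : circleMap p (δ / 2) 0 ∉ connectedComponentIn (W ∩ Metric.ball p δ) u)
    (hnet : ∀ s t, 0 ≤ s → t ≤ 2 * Real.pi → s + h < t → ∃ x ∈ Set.Ioo s t,
      circleMap p (δ / 2) x ∉ connectedComponentIn (W ∩ Metric.ball p δ) u) :
    HasLogRatio (Wᶜ ∪ circleMap p (δ / 2) '' Set.Icc 0 (2 * Real.pi) ∩
      connectedComponentIn (W ∩ Metric.ball p δ) u) u w := by
  set O := connectedComponentIn (W ∩ Metric.ball p δ) u with hO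
  set c := circleMap p (δ / 2) with hc
  have hcc : Continuous c := continuous_circleMap p _
  have hWB : IsOpen (W ∩ Metric.ball p δ) := hWo.inter Metric.isOpen_ball
  have hOo : IsOpen O := hWB.connectedComponentIn
  have hOW : O ⊆ W := (connectedComponentIn_subset _ _).trans Set.inter_subset_left
  have hcs : ∀ t, dist (c t) p = δ / 2 := fun t => circleMap_mem_sphere p (half_pos hδ).le t
  have hcB : ∀ t, c t ∈ Metric.ball p δ := fun t => by
    rw [Metric.mem_ball, hcs]
    exact half_lt_self hδ
  have hup := Metric.mem_ball.mp hu.2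
  have hc2 : c (2 * Real.pi) = c 0 := by
    have := periodic_circleMap p (δ / 2) 0
    rwa [zero_add] at this
  have hZ : IsCompact (Set.Icc 0 (2 * Real.pi) ∩ c ⁻¹' Oᶜ) :=
    isCompact_Icc.inter_right (hOo.isClosed_compl.preimage hcc)
  refine hZ.induction_of_gaps (a := 0) (b := 2 * Real.pi)
    (L := fun s t => HasLogRatio (Wᶜ ∪ c '' Set.Icc s t ∩ O) u w)
    ⟨⟨⟨le_rfl, Real.two_pi_pos.le⟩, h0⟩, fun t ht => ht.1.1⟩
    ⟨⟨⟨Real.two_pi_pos.le, le_rfl⟩, fun h => h0 (hc2 ▸ h)⟩, fun t ht => ht.1.2⟩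
    ?_ (fun T hT => exists_hasLogRatio_circleMap_near hWo hWc hu.1 hw Metric.isOpen_ball hcB hT.2)
    ?_
  · intro s hs t ht r hr hst htr hL1 hL2
    have hcl : ∀ s t, IsClosed (Wᶜ ∪ c '' Set.Icc s t ∩ O) := fun s t =>
      isClosed_compl_union_inter_component hWo Metric.isOpen_ball
        (isCompact_Icc.image hcc).isClosed (by rintro _ ⟨x, -, rfl⟩; exact hcB x)
    have hint : (Wᶜ ∪ c '' Set.Icc s t ∩ O) ∩ (Wᶜ ∪ c '' Set.Icc t r ∩ O) = Wᶜ := by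
      rw [← Set.union_inter_distrib_left, Set.union_eq_left]
      rintro _ ⟨⟨⟨x, hx, rfl⟩, hxO⟩, ⟨y, hy, hyx⟩, -⟩
      exfalso
      have hx0 : x ≠ 0 := fun e => h0 (e ▸ hxO)
      have hxp : 0 < x := lt_of_le_of_ne (hs.1.1.trans hx.1) hx0.symm
      have : x = y := by
        refine eq_of_circleMap_eq (half_pos hδ).ne' ?_ hyx.symm
        rw [abs_lt]
        constructor <;> linarith [hx.2, hy.1, hy.2, hr.1.2]
      subst this
      exact ht.2 (le_antisymm hx.2 hy.1 ▸ hxO)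
    rw [← Set.Icc_union_Icc_eq_Icc hst htr, Set.image_union, Set.union_inter_distrib_right,
      Set.union_union_distrib_left]
    exact hL1.union (hcl s t) (hcl t r) (by rwa [hint]) (by rw [hint]; exact fun h => h hw) hL2
  · intro s hs t ht hst hdisj
    have hsub : c '' Set.Ioo s t ⊆ O := by
      rintro _ ⟨x, hx, rfl⟩
      by_contra hxO
      exact hdisj.notMem_of_mem_left hx ⟨⟨hs.1.1.trans hx.1.le, hx.2.le.trans ht.1.2⟩, hxO⟩
    have hle : t - s ≤ h := by
      by_contra! hcon
      obtain ⟨x, hx, hxO⟩ := hnet s t hs.1.1 ht.1.2 (by linarith)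
      exact hxO (hsub ⟨x, hx, rfl⟩)
    have hfr : ∀ x ∈ Set.Icc s t, c x ∉ O → c x ∈ frontier W := fun x hx hxO => by
      have hcl : c x ∈ closure O := by
        refine closure_mono hsub ?_
        rw [← closure_Ioo hst.ne] at hx
        exact image_closure_subset_closure_image hcc ⟨x, hx, rfl⟩
      rw [hWo.frontier_eq]
      refine ⟨closure_mono hOW hcl, fun hxW => ?_⟩
      exact (disjoint_frontier_connectedComponentIn hWB u).notMem_of_mem_left
        (hOo.frontier_eq ▸ ⟨hcl, hxO⟩) ⟨hxW, hcB x⟩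
    have hγ : IsCrosscut W (c '' Set.Ioo s t) :=
      isCrosscut_circleMap (half_pos hδ).ne' hst (by linarith)
        (hfr s ⟨le_rfl, hst.le⟩ hs.2) (hfr t ⟨hst.le, le_rfl⟩ ht.2) (hsub.trans hOW)
    have hnotin : ∀ z, dist z p ≠ δ / 2 → z ∉ c '' Set.Ioo s t := by
      rintro _ hz ⟨x, -, rfl⟩
      exact hz (hcs x)
    have hwγ : w ∉ c '' Set.Ioo s t := hnotin w (by linarith)
    have huγ : u ∉ c '' Set.Ioo s t := hnotin u (by linarith)
    have hdiam : Metric.diam (closure (c '' Set.Ioo s t)) ≤ δ / 2 * h := by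
      rw [Metric.diam_closure]
      refine Metric.diam_le_of_forall_dist_le (by nlinarith) ?_
      rintro _ ⟨x, hx, rfl⟩ _ ⟨y, hy, rfl⟩
      refine (dist_circleMap_le (half_pos hδ).le x y).trans ?_
      refine mul_le_mul_of_nonneg_left ?_ (half_pos hδ).le
      rw [abs_le]
      constructor <;> linarith [hx.1, hx.2, hy.1, hy.2]
    have huN : u ∉ crosscutNbhd W w (c '' Set.Ioo s t) := fun huN => by
      obtain ⟨_, ⟨x, -, rfl⟩, hx⟩ :=
        hγ.exists_dist_le_diam hWo hWb hWc.isPreconnected hw huN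
      have h1 := hx u (subset_closure huN)
      have h2 := hsmall _ hγ hwγ hdiam
      linarith [dist_triangle_left (c x) p u, hcs x]
    have huWγ : u ∈ W \ (c '' Set.Ioo s t) := ⟨hu.1, huγ⟩
    have hwu : w ∈ connectedComponentIn (W \ (c '' Set.Ioo s t)) u := by
      by_contra hcon
      exact huN ⟨huWγ, hcon⟩
    refine (hasLogRatio_of_isPreconnected (hγ.isClosed_compl_union hWo)
      isPreconnected_connectedComponentIn ?_ (mem_connectedComponentIn huWγ) hwu).mono ?_
    · rw [Set.disjoint_left]
      intro x hx
      have := connectedComponentIn_subset _ _ hx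
      rintro (h | h)
      exacts [h this.1, this.2 h]
    · refine Set.union_subset_union_right _ ?_
      rintro _ ⟨⟨x, hx, rfl⟩, hxO⟩
      refine ⟨x, ⟨lt_of_le_of_ne hx.1 ?_, lt_of_le_of_ne hx.2 ?_⟩, rfl⟩
      · rintro rfl
        exact hs.2 hxO
      · rintro rfl
        exact ht.2 hxO

/-- Finitely many components of `W ∩ ball p δ` cover `W ∩ ball p (δ / 4)`. -/
theorem exists_finite_component (hWo : IsOpen W) (hWb : Bornology.IsBounded W)
    (hWc : IsConnected W) (hE : IsPreconnected Wᶜ) (hw : w ∈ W)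
    (hmod : ∀ ε > 0, ∃ δ > 0, ∀ γ, IsCrosscut W γ → w ∉ γ → Metric.diam (closure γ) < δ →
      Metric.diam (crosscutNbhd W w γ) < ε) {δ : ℝ} (hδ : 0 < δ) (hwp : δ ≤ dist w p) :
    ∃ F : Set ℂ, F.Finite ∧ ∀ u ∈ W ∩ Metric.ball p (δ / 4),
      ∃ x ∈ F, x ∈ connectedComponentIn (W ∩ Metric.ball p δ) u := by
  obtain ⟨δ', hδ', hsmall⟩ := hmod (δ / 4) (by positivity)
  set h := min 1 (δ' / δ) with hh
  have hh0 : 0 < h := lt_min one_pos (div_pos hδ' hδ)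
  obtain ⟨F, hF, hnet⟩ := exists_finite_net (R := 2 * Real.pi) hh0
  refine ⟨circleMap p (δ / 2) '' insert 0 F, (hF.insert 0).image _, fun u hu => ?_⟩
  by_contra! hcon
  have hρ : 0 < δ / 2 := half_pos hδ
  set O := connectedComponentIn (W ∩ Metric.ball p δ) u with hO
  have hL := hasLogRatio_circleMap_of_gaps hWo hWb hWc hE hw hδ hwp hu (h := h)
    ((min_le_left _ _).trans_lt (by linarith [Real.pi_gt_three]))
    (fun γ hγ hwγ hd => hsmall γ hγ hwγ (hd.trans_lt ?_))
    (hcon _ (Set.mem_image_of_mem _ (Set.mem_insert _ _)))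
    fun s t hs ht hst => ?_
  · have hup := Metric.mem_ball.mp hu.2
    have hWB : IsOpen (W ∩ Metric.ball p δ) := hWo.inter Metric.isOpen_ball
    have hcl : closure (O ∩ Metric.ball p (δ / 2)) ⊆ Metric.closedBall p (δ / 2) :=
      closure_minimal (Set.inter_subset_right.trans Metric.ball_subset_closedBall)
        Metric.isClosed_closedBall
    refine not_hasLogRatio_frontier (V := O ∩ Metric.ball p (δ / 2)) (q := w)
      (Metric.isBounded_ball.subset Set.inter_subset_right)
      ⟨mem_connectedComponentIn ⟨hu.1, Metric.ball_subset_ball (by linarith) hu.2⟩,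
        Metric.ball_subset_ball (by linarith) hu.2⟩ (fun hw' => ?_) (hL.mono fun x hx => ?_)
    · have := Metric.mem_closedBall.mp (hcl hw')
      linarith
    · rw [(hWB.connectedComponentIn.inter Metric.isOpen_ball).frontier_eq] at hx
      by_cases hxW : x ∈ W
      · have hxb := Metric.mem_closedBall.mp (hcl hx.1)
        have hxO : x ∈ O := by
          by_contra hxO
          refine (disjoint_frontier_connectedComponentIn hWB u).notMem_of_mem_left
            (hWB.connectedComponentIn.frontier_eq ▸
              ⟨closure_mono Set.inter_subset_left hx.1, hxO⟩) ⟨hxW, ?_⟩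
          rw [Metric.mem_ball]
          linarith
        have hxs : x ∈ Metric.sphere p |δ / 2| := by
          rw [abs_of_pos hρ, Metric.mem_sphere]
          refine le_antisymm hxb (not_lt.mp fun hlt => hx.2 ⟨hxO, hlt⟩)
        rw [← image_circleMap_Ioc] at hxs
        exact .inr ⟨Set.image_mono Set.Ioc_subset_Icc_self hxs, hxO⟩
      · exact .inl hxW
  · have : h * δ ≤ δ' := (le_div_iff₀ hδ).mp (min_le_right _ _)
    linarith
  · obtain ⟨x, hx, hxst⟩ := hnet s t hs ht hst
    exact ⟨x, hxst, hcon _ ⟨x, .inr hx, rfl⟩⟩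

end Circle

theorem exists_isClosed_separation {X : Set ℂ} (hX : IsCompact X) {p y : ℂ} (hp : p ∈ X)
    (hy : y ∈ X) (h : y ∉ connectedComponentIn X p) : ∃ P Q : Set ℂ, IsClosed P ∧ IsClosed Q ∧
      Disjoint P Q ∧ P ∪ Q = X ∧ p ∈ P ∧ y ∈ Q := by
  have : CompactSpace X := isCompact_iff_compactSpace.mp hX
  have h' : (⟨y, hy⟩ : X) ∉ connectedComponent (⟨p, hp⟩ : X) := fun hmem =>
    h (connectedComponentIn_eq_image hp ▸ ⟨_, hmem, rfl⟩)
  rw [connectedComponent_eq_iInter_isClopen, Set.mem_iInter] at h'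
  push Not at h'
  obtain ⟨⟨S, hS, hpS⟩, hyS⟩ := h'
  have hcl := hX.isClosed.isClosedEmbedding_subtypeVal.isClosedMap
  refine ⟨Subtype.val '' S, Subtype.val '' Sᶜ, hcl _ hS.isClosed, hcl _ hS.compl.isClosed,
    Set.disjoint_image_iff Subtype.val_injective |>.mpr disjoint_compl_right, ?_,
    ⟨_, hpS, rfl⟩, ⟨_, hyS, rfl⟩⟩
  rw [← Set.image_union, Set.union_compl_self, Set.image_univ, Subtype.range_coe]

section Backward

variable {W : Set ℂ} {w p : ℂ}

/-- A separation of the boundary near `p` yields a small segment crosscut joining the two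
parts, so that no connected subset of `W` near `p` is adherent to both of them. -/
theorem not_adherent_of_separation (hWo : IsOpen W) (hWb : Bornology.IsBounded W)
    (hWc : IsPreconnected W)
    (hlog : ∀ a ∉ W, ∃ g : ℂ → ℂ, ContinuousOn g W ∧ ∀ x ∈ W, x - a = exp (g x)) (hw : w ∈ W)
    {ε δ : ℝ} (hδε : 3 * δ ≤ ε / 2) (hδw : 3 * δ ≤ dist w p)
    (hsmall : ∀ γ, IsCrosscut W γ → w ∉ γ → Metric.diam (closure γ) ≤ 4 * δ →
      Metric.diam (crosscutNbhd W w γ) ≤ ε / 2) {P Q O : Set ℂ} (hP : IsClosed P)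
    (hQ : IsClosed Q) (hd : Disjoint P Q) (hPQ : P ∪ Q = frontier W ∩ Metric.closedBall p ε)
    (hO : IsPreconnected O) (hOW : O ⊆ W ∩ Metric.ball p δ) {x y : ℂ} (hx : x ∈ P)
    (hxO : x ∈ closure O) (hy : y ∈ Q) (hyO : y ∈ closure O) : False := by
  have hPx : P.Nonempty := ⟨x, hx⟩
  have hQy : Q.Nonempty := ⟨y, hy⟩
  have hPF : P ⊆ frontier W := fun z hz => (hPQ.subset (.inl hz)).1
  have hQF : Q ⊆ frontier W := fun z hz => (hPQ.subset (.inr hz)).1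
  have hFW : frontier W ⊆ Wᶜ := fun z hz => (hWo.frontier_eq ▸ hz).2
  have hcP := Metric.continuous_infDist_pt P
  have hcQ := Metric.continuous_infDist_pt Q
  have hx1 : Metric.infDist x P < Metric.infDist x Q := by
    rw [Metric.infDist_zero_of_mem hx]
    exact (hQ.notMem_iff_infDist_pos hQy).mp (hd.notMem_of_mem_left hx)
  have hy1 : Metric.infDist y Q < Metric.infDist y P := by
    rw [Metric.infDist_zero_of_mem hy]
    exact (hP.notMem_iff_infDist_pos hPx).mp (hd.notMem_of_mem_right hy)
  obtain ⟨x', hx', hx'O⟩ := mem_closure_iff.mp hxO _ (isOpen_lt hcP hcQ) hx1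
  obtain ⟨y', hy', hy'O⟩ := mem_closure_iff.mp hyO _ (isOpen_lt hcQ hcP) hy1
  obtain ⟨m, hmO, hm⟩ := hO.intermediate_value₂ hx'O hy'O hcP.continuousOn hcQ.continuousOn
    (le_of_lt hx') (le_of_lt hy')
  obtain ⟨a, ha, hma⟩ := hP.exists_infDist_eq_dist hPx m
  obtain ⟨b, hb, hmb⟩ := hQ.exists_infDist_eq_dist hQy m
  set r := Metric.infDist m P with hr
  have hmp := Metric.mem_ball.mp (hOW hmO).2
  have hxp : dist x p ≤ δ :=
    closure_minimal ((hOW.trans Set.inter_subset_right).trans Metric.ball_subset_closedBall)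
      Metric.isClosed_closedBall hxO
  have hr2 : r ≤ 2 * δ := by
    refine (Metric.infDist_le_dist_of_mem hx).trans ?_
    linarith [dist_triangle_right m x p]
  have hr0 : 0 < r := (hP.notMem_iff_infDist_pos hPx).mp fun hmP => hFW (hPF hmP) (hOW hmO).1
  have hball : Metric.ball m r ⊆ W := by
    refine (convex_ball m r).isPreconnected.subset_of_disjoint_frontier hWo ?_
      ⟨m, Metric.mem_ball_self hr0, (hOW hmO).1⟩
    rw [Set.disjoint_left]
    intro q hq hqm
    rw [Metric.mem_ball, dist_comm] at hqm
    have hqX : q ∈ P ∪ Q := by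
      refine hPQ ▸ ⟨hq, ?_⟩
      rw [Metric.mem_closedBall]
      linarith [dist_triangle_left q p m]
    rcases hqX with hq' | hq'
    · exact hqm.not_ge (Metric.infDist_le_dist_of_mem hq')
    · exact hqm.not_ge (hm.trans_le (Metric.infDist_le_dist_of_mem hq'))
  have hab : a ≠ b := fun e => hd.notMem_of_mem_left ha (e ▸ hb)
  have ham : a ∈ Metric.closedBall m r := by
    rw [Metric.mem_closedBall, dist_comm, ← hma]
  have hbm : b ∈ Metric.closedBall m r := by
    rw [Metric.mem_closedBall, dist_comm, ← hmb, hm]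
  have hseg : openSegment ℝ a b ⊆ Metric.ball m r := openSegment_subset_ball_of_ne ham hbm hab
  have hγ := isCrosscut_openSegment hab (hPF ha) (hQF hb) (hseg.trans hball)
  have hnear : ∀ q ∈ openSegment ℝ a b, dist q p < 3 * δ := fun q hq => by
    linarith [dist_triangle q m p, Metric.mem_ball.mp (hseg hq)]
  have hwγ : w ∉ openSegment ℝ a b := fun h => (hnear w h).not_ge hδw
  have hdiam : Metric.diam (closure (openSegment ℝ a b)) ≤ 4 * δ := by
    rw [Metric.diam_closure]
    calc _ ≤ Metric.diam (Metric.ball m r) := Metric.diam_mono hseg Metric.isBounded_ball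
      _ ≤ 2 * r := Metric.diam_ball hr0.le
      _ ≤ 4 * δ := by linarith
  obtain ⟨z, hz⟩ := nonempty_crosscutNbhd_openSegment (w := w) hWo hlog hab (hFW (hPF ha))
    (hFW (hQF hb)) hγ.subset
  refine not_separated_of_openSegment hWo hWb hWc hw hab hγ hwγ hz hP hQ (hPF.trans hFW)
    (hQF.trans hFW) ha hb ?_ hd
  rintro q ⟨hqW, hq⟩
  rw [hPQ, hWo.frontier_eq]
  obtain ⟨c, hc, hcq⟩ := hγ.exists_dist_le_diam hWo hWb hWc hw hz
  refine ⟨⟨closure_mono crosscutNbhd_subset hq, hqW⟩, ?_⟩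
  rw [Metric.mem_closedBall]
  linarith [dist_triangle q c p, hnear c hc, hcq q hq, hsmall _ hγ hwγ hdiam]

theorem exists_ball_subset_component_frontier (hWo : IsOpen W) (hWb : Bornology.IsBounded W)
    (hWc : IsConnected W)
    (hlog : ∀ a ∉ W, ∃ g : ℂ → ℂ, ContinuousOn g W ∧ ∀ x ∈ W, x - a = exp (g x)) (hw : w ∈ W)
    (hmod : ∀ ε > 0, ∃ δ > 0, ∀ γ, IsCrosscut W γ → w ∉ γ → Metric.diam (closure γ) < δ →
      Metric.diam (crosscutNbhd W w γ) < ε) (hp : p ∈ frontier W) {ε : ℝ} (hε : 0 < ε) :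
    ∃ δ > 0, ∀ y ∈ frontier W, dist y p < δ →
      y ∈ connectedComponentIn (frontier W ∩ Metric.closedBall p ε) p := by
  obtain ⟨δ₀, hδ₀, hsmall⟩ := hmod (ε / 2) (half_pos hε)
  have hpW : p ∉ W := (hWo.frontier_eq ▸ hp).2
  have hwp : 0 < dist w p := dist_pos.mpr fun e => hpW (e ▸ hw)
  obtain ⟨δ, hδ, hδ1⟩ := exists_between (lt_min (lt_min (show 0 < ε / 6 by positivity)
    (show 0 < δ₀ / 4 by positivity)) (show 0 < dist w p / 3 by positivity))
  rw [lt_min_iff, lt_min_iff] at hδ1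
  obtain ⟨⟨hδε, hδδ₀⟩, hδw⟩ := hδ1
  obtain ⟨F, hF, hFc⟩ := exists_finite_component hWo hWb hWc
    (isPreconnected_compl_of_exists_log hWo hWb hlog) hw hmod hδ (p := p) (by linarith)
  have hev : ∀ᶠ y in nhds p, ∀ x ∈ F,
      y ∈ closure (connectedComponentIn (W ∩ Metric.ball p δ) x) →
        p ∈ closure (connectedComponentIn (W ∩ Metric.ball p δ) x) := by
    refine (Filter.eventually_all_finite hF).mpr fun x _ => ?_
    by_cases hpx : p ∈ closure (connectedComponentIn (W ∩ Metric.ball p δ) x)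
    · exact .of_forall fun _ _ => hpx
    · filter_upwards [isClosed_closure.isOpen_compl.mem_nhds hpx] with y hy hy'
      exact absurd hy' hy
  obtain ⟨δ', hδ', hball⟩ := Metric.eventually_nhds_iff.mp hev
  refine ⟨min δ' (δ / 4), lt_min hδ' (by positivity), fun y hy hyp => ?_⟩
  rw [lt_min_iff] at hyp
  by_contra hcon
  have hX : IsCompact (frontier W ∩ Metric.closedBall p ε) :=
    (isCompact_closedBall p ε).inter_left isClosed_frontier
  obtain ⟨P, Q, hP, hQ, hd, hPQ, hpP, hyQ⟩ := exists_isClosed_separation hX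
    ⟨hp, Metric.mem_closedBall_self hε.le⟩
    ⟨hy, Metric.mem_closedBall.mpr (by linarith [hyp.2])⟩ hcon
  have hyF : y ∈ ⋃ x ∈ F, closure (connectedComponentIn (W ∩ Metric.ball p δ) x) := by
    rw [← hF.closure_biUnion]
    refine closure_mono ?_ (Metric.isOpen_ball.inter_closure
      ⟨Metric.mem_ball.mpr hyp.2, frontier_subset_closure hy⟩)
    rintro u ⟨hub, huW⟩
    obtain ⟨x, hxF, hx⟩ := hFc u ⟨huW, hub⟩
    refine Set.mem_biUnion hxF ?_
    rw [← connectedComponentIn_eq hx]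
    exact mem_connectedComponentIn ⟨huW, Metric.ball_subset_ball (by linarith) hub⟩
  obtain ⟨x, hxF, hyx⟩ := Set.mem_iUnion₂.mp hyF
  exact not_adherent_of_separation hWo hWb hWc.isPreconnected hlog hw (by linarith)
    (by linarith) (fun γ hγ hwγ hdiam => (hsmall γ hγ hwγ (by linarith)).le) hP hQ hd hPQ
    isPreconnected_connectedComponentIn (connectedComponentIn_subset _ _) hpP
    (hball hyp.1 x hxF hyx) hyQ hyx

theorem locallyConnectedSpace_frontier_of_diam_crosscutNbhd_lt (hWo : IsOpen W)
    (hWb : Bornology.IsBounded W) (hWc : IsConnected W)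
    (hlog : ∀ a ∉ W, ∃ g : ℂ → ℂ, ContinuousOn g W ∧ ∀ x ∈ W, x - a = exp (g x)) (hw : w ∈ W)
    (hmod : ∀ ε > 0, ∃ δ > 0, ∀ γ, IsCrosscut W γ → w ∉ γ → Metric.diam (closure γ) < δ →
      Metric.diam (crosscutNbhd W w γ) < ε) : LocallyConnectedSpace (frontier W) := by
  rw [locallyConnectedSpace_iff_connected_subsets]
  rintro ⟨p, hp⟩ U hU
  obtain ⟨ε, hε, hεU⟩ := Metric.mem_nhds_iff.mp hU
  obtain ⟨δ, hδ, h⟩ := exists_ball_subset_component_frontier hWo hWb hWc hlog hw hmod hp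
    (half_pos hε)
  have hsub := connectedComponentIn_subset (frontier W ∩ Metric.closedBall p (ε / 2)) p
  refine ⟨Subtype.val ⁻¹' connectedComponentIn (frontier W ∩ Metric.closedBall p (ε / 2)) p,
    Metric.mem_nhds_iff.mpr ⟨δ, hδ, fun y hy => h y y.2 hy⟩, ?_, fun y hy => hεU ?_⟩
  · rw [← Topology.IsInducing.subtypeVal.isPreconnected_image, Subtype.image_preimage_coe,
      Set.inter_eq_right.mpr (hsub.trans Set.inter_subset_left)]
    exact isPreconnected_connectedComponentIn
  · exact (Metric.mem_closedBall.mp (hsub hy).2).trans_lt (half_lt_self hε)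

theorem IsCaratheodoryModulus.exists_diam_crosscutNbhd_lt {a : ℝ} (ha : 0 < a) {η : ℝ → ℝ}
    (hη : IsCaratheodoryModulus W w a η)
    (hη0 : Filter.Tendsto η (nhdsWithin 0 (Set.Ioi 0)) (nhds 0)) {ε : ℝ} (hε : 0 < ε) :
    ∃ δ > 0, ∀ γ, IsCrosscut W γ → w ∉ γ → Metric.diam (closure γ) < δ →
      Metric.diam (crosscutNbhd W w γ) < ε := by
  obtain ⟨d, hd, h⟩ := Metric.tendsto_nhdsWithin_nhds.mp hη0 ε hε
  refine ⟨min d a, lt_min hd ha, fun γ hγ hwγ hdiam => ?_⟩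
  obtain ⟨r, hr, hr'⟩ := exists_between hdiam
  rw [lt_min_iff] at hr'
  have hr0 : 0 < r := Metric.diam_nonneg.trans_lt hr
  have h1 := h (x := r) hr0 (by rw [Real.dist_eq, sub_zero, abs_of_pos hr0]; exact hr'.1)
  rw [Real.dist_eq, sub_zero] at h1
  exact (hη.2 γ hγ hwγ r hr hr'.2).trans ((le_abs_self _).trans_lt h1)

end Backward

/-- The boundary of a pointed simply connected domain is locally connected if and
only if `(W, w)` has a Carathéodory modulus tending to `0` at `0`. -/
theorem locallyConnected_iff_caratheodory_modulus (W : Set ℂ) (w : ℂ)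
    (hWb : Bornology.IsBounded W) (hWo : IsOpen W) (hWc : IsConnected W)
    (hWsc : SimplyConnectedSpace W) (hw : w ∈ W) :
    LocallyConnectedSpace (frontier W) ↔
      ∃ a : ℝ, 0 < a ∧ ∃ η : ℝ → ℝ, IsCaratheodoryModulus W w a η ∧
        Filter.Tendsto η (nhdsWithin 0 (Set.Ioi 0)) (nhds 0) := by
  constructor
  · intro _
    exact ⟨1, one_pos, exists_isCaratheodoryModulus hWb fun ε hε =>
      exists_diam_crosscutNbhd_le hWo hWb hWc.isPreconnected hw hε⟩
  · rintro ⟨a, ha, η, hη, hη0⟩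
    exact locallyConnectedSpace_frontier_of_diam_crosscutNbhd_lt hWo hWb hWc
      (fun b hb => exists_log_of_isSimplyConnected hWsc hWo (by fun_prop)
        fun x hx => sub_ne_zero.mpr fun e => hb (e ▸ hx)) hw
      fun ε hε => hη.exists_diam_crosscutNbhd_lt ha hη0 hε
end

section
/- Let X ⊆ ℝ² be a compact connected set and let m : (0,a) → ℝ be a modulus of local connectivity for X. Then for all x, y ∈ X and r with dist(x,y) < r < a, there exists a continuous path γ : [0,1] → ℝ² with image contained in X, γ(0) = x, γ(1) = y, and diam(γ([0,1])) ≤ m(r). -/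
open Metric

/-- `m : (0,a) → ℝ` is a modulus of local connectivity for `X ⊆ ℝ²`: it is
strictly increasing, tends to `0` at `0⁺`, and any two points of `X` at distance
less than `r < a` lie in a common connected subset of `X` of diameter less
than `m r`. -/
def IsModulusOfLocalConnectivity (X : Set (EuclideanSpace ℝ (Fin 2))) (a : ℝ)
    (m : ℝ → ℝ) : Prop :=
  StrictMonoOn m (Set.Ioo 0 a) ∧
  Filter.Tendsto m (nhdsWithin 0 (Set.Ioi 0)) (nhds 0) ∧
  ∀ x ∈ X, ∀ y ∈ X, ∀ r : ℝ, dist x y < r → r < a →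
    ∃ L : Set (EuclideanSpace ℝ (Fin 2)), L ⊆ X ∧ IsConnected L ∧
      x ∈ L ∧ y ∈ L ∧ Metric.diam L < m r

/-- The first `N` steps of the sequence `F` in `X` form a `δ`-chain from `x` to `y`. -/
structure IsDeltaChain {E : Type*} [PseudoMetricSpace E] (X : Set E) (x y : E) (δ : ℝ)
    (F : ℕ → E) (N : ℕ) : Prop where
  mem : ∀ j, F j ∈ X
  zero : F 0 = x
  last : F N = y
  step : ∀ j < N, dist (F j) (F (j + 1)) < δ

/-- A connected set contains arbitrarily fine chains between any two of its points, stationary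
from some index on. -/
theorem IsPreconnected.exists_isDeltaChain {E : Type*} [PseudoMetricSpace E] {L : Set E}
    (hL : IsPreconnected L) {x y : E} (hx : x ∈ L) (hy : y ∈ L) {δ : ℝ} (hδ : 0 < δ) :
    ∃ F n₀, ∀ n ≥ n₀, IsDeltaChain L x y δ F n := by
  have key : Relation.ReflTransGen (fun u v : E => v ∈ L ∧ dist u v < δ) x y := by
    refine hL.induction₂' (Relation.ReflTransGen fun u v => v ∈ L ∧ dist u v < δ)
      (fun u hu => ?_) (fun _ _ _ _ _ _ => Relation.ReflTransGen.trans) hx hy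
    filter_upwards [self_mem_nhdsWithin, mem_nhdsWithin_of_mem_nhds (ball_mem_nhds u hδ)]
      with v hv huv
    exact ⟨.single ⟨hv, mem_ball'.1 huv⟩, .single ⟨hu, huv⟩⟩
  clear hy
  induction key with
  | refl =>
    exact ⟨fun _ => x, 0, fun n _ => ⟨fun _ => hx, rfl, rfl, fun _ _ => by simpa⟩⟩
  | @tail u v _ huv ih =>
    obtain ⟨F, n₀, hF⟩ := ih
    have h₀ := hF n₀ le_rfl
    refine ⟨fun j => if j ≤ n₀ then F j else v, n₀ + 1, fun n hn => ⟨fun j => ?_, ?_, ?_, ?_⟩⟩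
    · split_ifs
      exacts [h₀.mem j, huv.1]
    · simpa using h₀.zero
    · simp [show ¬ n ≤ n₀ by omega]
    · intro j _
      rcases lt_trichotomy j n₀ with h | rfl | h
      · simpa [h.le, Nat.succ_le_of_lt h] using h₀.step j h
      · simpa [h₀.last] using huv.2
      · simpa [show ¬ j ≤ n₀ by omega, show ¬ j + 1 ≤ n₀ by omega] using hδ

/-- If nearby points of `X` lie in small connected subsets of `X`, a chain can be refined to an
arbitrarily fine one while staying close to the original. -/
theorem IsDeltaChain.exists_refinement {E : Type*} [PseudoMetricSpace E] {X : Set E} {x y : E}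
    {δ δ' η : ℝ} {F : ℕ → E} {N : ℕ} (hF : IsDeltaChain X x y δ F N) (hη : 0 ≤ η) (hδ' : 0 < δ')
    (hX : ∀ u ∈ X, ∀ v ∈ X, dist u v < δ →
      ∃ L ⊆ X, IsPreconnected L ∧ u ∈ L ∧ v ∈ L ∧ ∀ w ∈ L, dist u w ≤ η) :
    ∃ G n, 0 < n ∧ IsDeltaChain X x y δ' G (N * n) ∧
      ∀ j ≤ N * n, dist (F (j / n)) (G j) ≤ η := by
  have hc : ∀ i, ∃ c : ℕ → E, ∃ n₀, (∀ j, c j ∈ X) ∧ c 0 = F i ∧ (i < N →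
      (∀ j, dist (F i) (c j) ≤ η) ∧ ∀ n ≥ n₀, IsDeltaChain X (F i) (F (i + 1)) δ' c n) := by
    intro i
    by_cases hi : i < N
    · obtain ⟨L, hLX, hL, hu, hv, hd⟩ := hX _ (hF.mem i) _ (hF.mem (i + 1)) (hF.step i hi)
      obtain ⟨c, n₀, hc⟩ := hL.exists_isDeltaChain hu hv hδ'
      have h₀ := hc n₀ le_rfl
      exact ⟨c, n₀, fun j => hLX (h₀.mem j), h₀.zero, fun _ => ⟨fun j => hd _ (h₀.mem j),
        fun n hn => ⟨fun j => hLX (h₀.mem j), h₀.zero, (hc n hn).last, (hc n hn).step⟩⟩⟩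
    · exact ⟨fun _ => F i, 0, fun _ => hF.mem i, rfl, fun h => absurd h hi⟩
  choose c n₀ hcX hc0 hc using hc
  obtain ⟨n, hn0, hn⟩ : ∃ n, 0 < n ∧ ∀ i < N, n₀ i ≤ n :=
    ⟨(Finset.range N).sup n₀ + 1, Nat.succ_pos _, fun i hi =>
      (Finset.le_sup (f := n₀) (Finset.mem_range.2 hi)).trans (Nat.le_succ _)⟩
  refine ⟨fun j => c (j / n) (j % n), n, hn0, ⟨fun j => hcX _ _, ?_, ?_, ?_⟩, ?_⟩
  · simp [hc0, hF.zero]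
  · simp [hc0, hF.last, hn0]
  · intro j hj
    have hi : j / n < N := (Nat.div_lt_iff_lt_mul hn0).2 hj
    have hch := (hc _ hi).2 n (hn _ hi)
    have hlt := Nat.mod_lt j hn0
    have hst := hch.step (j % n) hlt
    have hdm := Nat.div_add_mod j n
    rcases Nat.lt_or_ge (j % n + 1) n with h | h
    · have h1 : (j + 1) / n = j / n := by
        rw [Nat.div_eq_iff hn0, mul_comm]
        constructor <;> omega
      have h2 : (j + 1) % n = j % n + 1 := by
        rw [Nat.add_mod, Nat.mod_eq_of_lt (a := 1) (by omega), Nat.mod_eq_of_lt h]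
      rwa [h1, h2]
    · have h0 : j % n + 1 = n := by omega
      have h3 : j + 1 = n * (j / n + 1) := by rw [mul_add, mul_one]; omega
      rw [h3, Nat.mul_div_cancel_left _ hn0, Nat.mul_mod_right, hc0, ← hch.last]
      rwa [h0] at hst
  · intro j hj
    rcases hj.lt_or_eq with h | rfl
    · exact (hc _ ((Nat.div_lt_iff_lt_mul hn0).2 h)).1 _
    · simpa [hc0, hn0] using hη

/-- In a complete uniformly locally connected set, a sufficiently fine chain can be followed closely
by a path. -/
theorem exists_path_of_uniformly_locally_connected {E : Type*} [MetricSpace E] {X : Set E}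
    (hXc : IsComplete X) (hX : ∀ η > 0, ∃ δ > 0, ∀ u ∈ X, ∀ v ∈ X, dist u v < δ →
      ∃ L ⊆ X, IsPreconnected L ∧ u ∈ L ∧ v ∈ L ∧ ∀ w ∈ L, dist u w ≤ η)
    {L : Set E} (hLX : L ⊆ X) (hL : IsPreconnected L) {x y : E} (hx : x ∈ L) (hy : y ∈ L)
    {ε : ℝ} (hε : 0 < ε) :
    ∃ γ : ℝ → E, ContinuousOn γ (Set.Icc 0 1) ∧ γ 0 = x ∧ γ 1 = y ∧
      ∀ t ∈ Set.Icc (0 : ℝ) 1, γ t ∈ X ∧ ∃ z ∈ L, dist z (γ t) ≤ ε := by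
  choose! d hd0 hd using hX
  let η : ℕ → ℝ := fun k => ε / 2 / 2 ^ k
  have hη : ∀ k, 0 < η k := fun k => by positivity
  let δ : ℕ → ℝ := fun k => min (η k) (d (η k))
  have hδ : ∀ k, 0 < δ k := fun k => lt_min (hη k) (hd0 _ (hη k))
  obtain ⟨F₀, N₀, h₀⟩ := hL.exists_isDeltaChain hx hy (hδ 0)
  have h₀ := h₀ (N₀ + 1) (Nat.le_succ _)
  let S : ℕ → Type _ := fun k => {p : (ℕ → E) × ℕ // 0 < p.2 ∧ IsDeltaChain X x y (δ k) p.1 p.2}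
  have hstep : ∀ k (p : S k), ∃ q : S (k + 1), ∃ n, 0 < n ∧ q.1.2 = p.1.2 * n ∧
      ∀ j ≤ p.1.2 * n, dist (p.1.1 (j / n)) (q.1.1 j) ≤ η k := by
    intro k p
    obtain ⟨G, n, hn, hG, hGd⟩ := p.2.2.exists_refinement (hη k).le (hδ (k + 1))
      (fun u hu v hv huv => hd _ (hη k) u hu v hv (huv.trans_le (min_le_right _ _)))
    exact ⟨⟨(G, p.1.2 * n), Nat.mul_pos p.2.1 hn, hG⟩, n, hn, rfl, hGd⟩
  choose next n hn hN hdist using hstep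
  let s : ∀ k, S k := fun k => Nat.rec (motive := S)
    ⟨(F₀, N₀ + 1), Nat.succ_pos _, fun j => hLX (h₀.mem j), h₀.zero, h₀.last, h₀.step⟩ next k
  let f : ℕ → ℝ → E := fun k t => (s k).1.1 ⌊t * (s k).1.2⌋₊
  have hfloor : ∀ k, ∀ t ∈ Set.Icc (0 : ℝ) 1, ⌊t * (s k).1.2⌋₊ ≤ (s k).1.2 := fun k t ht =>
    Nat.floor_le_of_le (mul_le_of_le_one_left (Nat.cast_nonneg _) ht.2)
  have hsucc : ∀ t ∈ Set.Icc (0 : ℝ) 1, ∀ k, dist (f k t) (f (k + 1) t) ≤ η k := by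
    intro t ht k
    have hNk : (s (k + 1)).1.2 = (s k).1.2 * n k (s k) := hN k (s k)
    have hpos : (n k (s k) : ℝ) ≠ 0 := Nat.cast_ne_zero.2 (hn k (s k)).ne'
    have h1 : ⌊t * (s k).1.2⌋₊ = ⌊t * (s (k + 1)).1.2⌋₊ / n k (s k) := by
      rw [← Nat.floor_div_natCast, hNk]
      congr 1
      push_cast
      field_simp
    change dist ((s k).1.1 _) ((s (k + 1)).1.1 _) ≤ _
    rw [h1]
    exact hdist k (s k) _ (hNk ▸ hfloor (k + 1) t ht)
  have hfX : ∀ k t, f k t ∈ X := fun k t => (s k).2.2.mem _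
  have hlim : ∀ t, ∃ z, t ∈ Set.Icc (0 : ℝ) 1 →
      z ∈ X ∧ Filter.Tendsto (fun k => f k t) Filter.atTop (nhds z) := by
    intro t
    by_cases ht : t ∈ Set.Icc (0 : ℝ) 1
    · obtain ⟨z, hz, h⟩ := cauchySeq_tendsto_of_isComplete hXc (fun k => hfX k t)
        (cauchySeq_of_le_geometric_two (hsucc t ht))
      exact ⟨z, fun _ => ⟨hz, h⟩⟩
    · exact ⟨x, fun h => absurd h ht⟩
  choose γ hγ using hlim
  have hγd : ∀ t ∈ Set.Icc (0 : ℝ) 1, ∀ k, dist (f k t) (γ t) ≤ ε / 2 ^ k := fun t ht k =>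
    dist_le_of_le_geometric_two_of_tendsto (hsucc t ht) (hγ t ht).2 k
  have hfeq : ∀ k, ∀ u v : ℝ, 0 ≤ u → u ≤ v → v ≤ 1 → v - u < 1 / (s k).1.2 →
      dist (f k u) (f k v) ≤ η k := by
    intro k u v hu huv hv huv'
    have hNpos : (0 : ℝ) < (s k).1.2 := Nat.cast_pos.2 (s k).2.1
    rw [lt_div_iff₀ hNpos] at huv'
    have hle : ⌊u * (s k).1.2⌋₊ ≤ ⌊v * (s k).1.2⌋₊ := Nat.floor_mono (by gcongr)
    have hle' : ⌊v * (s k).1.2⌋₊ ≤ ⌊u * (s k).1.2⌋₊ + 1 := by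
      rw [← Nat.floor_add_one (by positivity)]
      exact Nat.floor_mono (by linarith)
    have hvN := hfloor k v ⟨hu.trans huv, hv⟩
    change dist ((s k).1.1 _) ((s k).1.1 _) ≤ _
    rcases hle.eq_or_lt with h | h
    · rw [h, dist_self]
      exact (hη k).le
    · rw [show ⌊v * (s k).1.2⌋₊ = ⌊u * (s k).1.2⌋₊ + 1 by omega]
      exact ((s k).2.2.step _ (by omega)).le.trans (min_le_left _ _)
  have hosc : ∀ k, ∀ u ∈ Set.Icc (0 : ℝ) 1, ∀ v ∈ Set.Icc (0 : ℝ) 1, dist u v < 1 / (s k).1.2 →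
      dist (γ u) (γ v) ≤ 3 * (ε / 2 ^ k) := by
    intro k u hu v hv huv
    have hmid : dist (f k u) (f k v) ≤ η k := by
      rcases le_total u v with h | h
      · rw [dist_comm, Real.dist_eq, abs_of_nonneg (sub_nonneg.2 h)] at huv
        exact hfeq k u v hu.1 h hv.2 huv
      · rw [Real.dist_eq, abs_of_nonneg (sub_nonneg.2 h)] at huv
        rw [dist_comm]
        exact hfeq k v u hv.1 h hu.2 huv
    have hηk : η k ≤ ε / 2 ^ k := by
      change ε / 2 / 2 ^ k ≤ _
      gcongr
      linarith
    have := dist_triangle4 (γ u) (f k u) (f k v) (γ v)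
    have := hγd u hu k
    have := hγd v hv k
    linarith [dist_comm (γ u) (f k u)]
  refine ⟨γ, ?_, ?_, ?_, fun t ht => ⟨(hγ t ht).1, f 0 t, ?_, ?_⟩⟩
  · rw [Metric.continuousOn_iff]
    intro u hu e he
    obtain ⟨k, hk⟩ := ((tendsto_const_nhds (x := 3 * ε)).div_atTop
      (tendsto_pow_atTop_atTop_of_one_lt (one_lt_two (α := ℝ)))).eventually_lt_const he |>.exists
    refine ⟨1 / (s k).1.2, one_div_pos.2 (Nat.cast_pos.2 (s k).2.1), fun v hv huv => ?_⟩
    have := hosc k v hv u hu huv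
    rw [← mul_div_assoc] at this
    exact this.trans_lt hk
  · refine tendsto_nhds_unique (hγ 0 (by simp)).2 (tendsto_const_nhds.congr fun k => ?_)
    simpa [f] using (s k).2.2.zero.symm
  · refine tendsto_nhds_unique (hγ 1 (by simp)).2 (tendsto_const_nhds.congr fun k => ?_)
    simpa [f] using (s k).2.2.last.symm
  · exact h₀.mem _
  · simpa using hγd t ht 0

/-- A modulus of local connectivity for a compact connected planar set is also a
modulus of path connectivity: nearby points are joined by small paths in `X`. -/
theorem modulus_gives_paths (X : Set (EuclideanSpace ℝ (Fin 2)))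
    (hXc : IsCompact X) (hXconn : IsConnected X) (a : ℝ) (m : ℝ → ℝ)
    (hm : IsModulusOfLocalConnectivity X a m) :
    ∀ x ∈ X, ∀ y ∈ X, ∀ r : ℝ, dist x y < r → r < a →
      ∃ γ : ℝ → EuclideanSpace ℝ (Fin 2), ContinuousOn γ (Set.Icc 0 1) ∧
        γ '' Set.Icc 0 1 ⊆ X ∧ γ 0 = x ∧ γ 1 = y ∧
        Metric.diam (γ '' Set.Icc 0 1) ≤ m r := by
  obtain ⟨-, hm0, hmL⟩ := hm
  intro x hx y hy r hxr hra
  have ha : 0 < a := (dist_nonneg.trans_lt hxr).trans hra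
  obtain ⟨L, hLX, hL, hxL, hyL, hLm⟩ := hmL x hx y hy r hxr hra
  have hX : ∀ η > 0, ∃ δ > 0, ∀ u ∈ X, ∀ v ∈ X, dist u v < δ →
      ∃ L ⊆ X, IsPreconnected L ∧ u ∈ L ∧ v ∈ L ∧ ∀ w ∈ L, dist u w ≤ η := by
    intro η hη
    obtain ⟨δ, ⟨hδη, hδa⟩, hδ⟩ := ((hm0.eventually_lt_const hη).and
      (eventually_nhdsWithin_of_eventually_nhds (eventually_lt_nhds ha))).and
      self_mem_nhdsWithin |>.exists
    refine ⟨δ, hδ, fun u hu v hv huv => ?_⟩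
    obtain ⟨K, hKX, hK, huK, hvK, hKm⟩ := hmL u hu v hv δ huv hδa
    exact ⟨K, hKX, hK.isPreconnected, huK, hvK, fun w hw =>
      (dist_le_diam_of_mem (hXc.isBounded.subset hKX) huK hw).trans (hKm.trans hδη).le⟩
  obtain ⟨γ, hγc, hγ0, hγ1, hγ⟩ := exists_path_of_uniformly_locally_connected hXc.isComplete hX hLX
    hL.isPreconnected hxL hyL (ε := (m r - diam L) / 2) (by linarith)
  refine ⟨γ, hγc, Set.image_subset_iff.2 fun t ht => (hγ t ht).1, hγ0, hγ1,
    diam_le_of_forall_dist_le (diam_nonneg.trans hLm.le) ?_⟩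
  rintro _ ⟨u, hu, rfl⟩ _ ⟨v, hv, rfl⟩
  obtain ⟨z, hz, hzu⟩ := (hγ u hu).2
  obtain ⟨w, hw, hwv⟩ := (hγ v hv).2
  have hzw := dist_le_diam_of_mem (hXc.isBounded.subset hLX) hz hw
  have := dist_triangle4 (γ u) z w (γ v)
  rw [dist_comm] at hzu
  linarith
end
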